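/- arXiv:1103.1979 — 5 statements merged into one kernel-verified Lean document; each statement's English description precedes it below -/
import Mathlib

section
/- Let p be a prime, let g = \sum_i a_i x^i be a nonzero polynomial with integer coefficients, let x_0 be an integer with g(x_0) \neq 0, and let n \geq 1 be an integer. Let c = min_i v_p(a_i) (minimum over indices with a_i \neq 0), let m = v_p(g'(x_0)) (with m = +\infty if g'(x_0) = 0), let \lambda = min(m + n, c + 2n), and let k = v_p(g(x_0)). Suppose k < \lambda. If either (i) k is odd, or (ii) k is even and there is no integer w with w^2 \equiv g(x_0)/p^k (mod p^{\lambda - k}), then for every x in the coset x_0 + p^n \mathbb{Z}_p of the p-adic integers, g(x) is not a square in \mathbb{Q}_p. -/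
open Polynomial

/-- Lemma 3.3 (criterion for `g(x)` not being a square in `ℚ_p` on a residue disc):
Let `g ∈ ℤ[x]` be nonzero, `x₀ ∈ ℤ` with `g(x₀) ≠ 0`, `n ≥ 1`,
`c = min_i v_p(aᵢ)` over the nonzero coefficients of `g`,
`m = v_p(g'(x₀))` (`= ∞` if `g'(x₀) = 0`), `λ = min(m + n, c + 2n)` and
`k = v_p(g(x₀))`.  If `k < λ` and either `k` is odd, or `k` is even and
`g(x₀)/p^k` is not a square modulo `p^(λ-k)`, then `g(x)` is not a square in
`ℚ_p` for every `x ∈ x₀ + pⁿ ℤ_p`. -/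
theorem not_square_on_residue_disc_Qp (p : ℕ) [Fact p.Prime]
    (g : Polynomial ℤ) (hg : g ≠ 0)
    (x₀ : ℤ) (hgx₀ : g.eval x₀ ≠ 0)
    (n : ℕ) (hn : 1 ≤ n)
    (c : ℕ)
    (hc : c = (g.support.inf' (Polynomial.support_nonempty.mpr hg)
                fun i => padicValInt p (g.coeff i)))
    (m : ℕ∞)
    (hm : m = if (Polynomial.derivative g).eval x₀ = 0 then (⊤ : ℕ∞)
              else (padicValInt p ((Polynomial.derivative g).eval x₀) : ℕ∞))
    (lam : ℕ)
    (hlam : (lam : ℕ∞) = min (m + (n : ℕ∞)) ((c : ℕ∞) + 2 * (n : ℕ∞)))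
    (k : ℕ) (hk : k = padicValInt p (g.eval x₀))
    (hklt : (k : ℕ∞) < (lam : ℕ∞))
    (hcond : Odd k ∨
      (Even k ∧ ¬ ∃ w : ℤ, ((p : ℤ) ^ (lam - k)) ∣ (w ^ 2 - g.eval x₀ / (p : ℤ) ^ k))) :
    ∀ x : ℤ_[p], (∃ t : ℤ_[p], x = (x₀ : ℤ_[p]) + (p : ℤ_[p]) ^ n * t) →
      ¬ ∃ s : ℚ_[p], s ^ 2 = ((Polynomial.aeval x g : ℤ_[p]) : ℚ_[p]) := by
  rintro x ⟨t, rfl⟩ ⟨s, hs⟩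
  have hp : p.Prime := Fact.out
  have hpz : (p : ℤ_[p]) ≠ 0 := by exact_mod_cast hp.ne_zero
  have hkl : k < lam := by exact_mod_cast hklt
  have hlc : lam ≤ c + 2 * n := by
    have : (lam : ℕ∞) ≤ (c : ℕ∞) + 2 * (n : ℕ∞) := hlam ▸ min_le_right _ _
    exact_mod_cast this
  have hlm : (lam : ℕ∞) ≤ m + n := hlam ▸ min_le_left _ _
  -- factor out the content
  have hcd : C ((p : ℤ) ^ c) ∣ g := by
    rw [Polynomial.C_dvd_iff_dvd_coeff]
    intro i
    by_cases hi : g.coeff i = 0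
    · simp [hi]
    · rw [padicValInt_dvd_iff]
      right
      rw [hc]
      exact Finset.inf'_le _ (Polynomial.mem_support_iff.mpr hi)
  obtain ⟨h, hh⟩ := hcd
  have hder : (p : ℤ) ^ lam ∣ (derivative g).eval x₀ * (p : ℤ) ^ n := by
    by_cases h0 : (derivative g).eval x₀ = 0
    · simp [h0]
    · rw [if_neg h0] at hm
      rw [hm] at hlm
      have h1 : lam ≤ padicValInt p ((derivative g).eval x₀) + n := by exact_mod_cast hlm
      refine (pow_dvd_pow _ h1).trans ?_
      rw [pow_add]
      exact mul_dvd_mul_right (padicValInt_dvd _) _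
  obtain ⟨d, hd⟩ := hder
  have hd' : (((derivative g).eval x₀ : ℤ) : ℤ_[p]) * (p : ℤ_[p]) ^ n
      = (p : ℤ_[p]) ^ lam * (d : ℤ_[p]) := by exact_mod_cast congrArg (Int.cast : ℤ → ℤ_[p]) hd
  obtain ⟨q, hq⟩ := (h.map (Int.castRingHom ℤ_[p])).binomExpansion (x₀ : ℤ_[p])
    ((p : ℤ_[p]) ^ n * t)
  have e1 : ∀ f : ℤ[X], (f.map (Int.castRingHom ℤ_[p])).eval (x₀ : ℤ_[p])
      = ((f.eval x₀ : ℤ) : ℤ_[p]) := by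
    intro f
    simpa using Polynomial.eval_map_apply (Int.castRingHom ℤ_[p]) (p := f) x₀
  rw [Polynomial.derivative_map, e1, e1] at hq
  have hk1 : (p : ℤ) ^ k ∣ g.eval x₀ := by rw [hk]; exact padicValInt_dvd _
  obtain ⟨u, hu⟩ := hk1
  have hpk : (p : ℤ) ^ k ≠ 0 := pow_ne_zero _ (by exact_mod_cast hp.ne_zero)
  have hudiv : g.eval x₀ / (p : ℤ) ^ k = u := by
    rw [hu, Int.mul_ediv_cancel_left _ hpk]
  rw [hudiv] at hcond
  have hup : ¬ (p : ℤ) ∣ u := by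
    rintro ⟨v, hv⟩
    have h2 : (p : ℤ) ^ (k + 1) ∣ g.eval x₀ := ⟨v, by rw [hu, hv]; ring⟩
    rw [padicValInt_dvd_iff] at h2
    rcases h2 with h2 | h2
    · exact hgx₀ h2
    · omega
  obtain ⟨e, he⟩ := Nat.exists_eq_add_of_lt hkl
  obtain ⟨b, hb⟩ := Nat.exists_eq_add_of_le hlc
  have hgx : ∃ r : ℤ_[p], aeval ((x₀ : ℤ_[p]) + (p : ℤ_[p]) ^ n * t) g
      = (p : ℤ_[p]) ^ k * ((u : ℤ_[p]) + (p : ℤ_[p]) ^ (lam - k) * r) := by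
    refine ⟨d * t + (p : ℤ_[p]) ^ b * q * t ^ 2, ?_⟩
    have hg0 : ((p : ℤ_[p]) ^ c) * ((h.eval x₀ : ℤ) : ℤ_[p]) = (p : ℤ_[p]) ^ k * (u : ℤ_[p]) := by
      have := hu
      rw [hh] at this
      simp only [eval_mul, eval_C] at this
      exact_mod_cast congrArg (Int.cast : ℤ → ℤ_[p]) this
    have hg1 : ((p : ℤ_[p]) ^ c) * (((derivative h).eval x₀ : ℤ) : ℤ_[p])
        * (p : ℤ_[p]) ^ n = (p : ℤ_[p]) ^ lam * (d : ℤ_[p]) := by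
      rw [← hd', hh, Polynomial.derivative_C_mul, Polynomial.eval_mul, Polynomial.eval_C]
      push_cast
      ring
    have hl : (p : ℤ_[p]) ^ lam = (p : ℤ_[p]) ^ k * (p : ℤ_[p]) ^ (lam - k) := by
      rw [← pow_add]; congr 1; omega
    have hcn : (p : ℤ_[p]) ^ c * ((p : ℤ_[p]) ^ n) ^ 2 = (p : ℤ_[p]) ^ lam * (p : ℤ_[p]) ^ b := by
      rw [← pow_add, ← hb]; ring
    have hA : aeval ((x₀ : ℤ_[p]) + (p : ℤ_[p]) ^ n * t) g = (p : ℤ_[p]) ^ c *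
        (h.map (Int.castRingHom ℤ_[p])).eval ((x₀ : ℤ_[p]) + (p : ℤ_[p]) ^ n * t) := by
      rw [hh, Polynomial.eval_map, Polynomial.aeval_def, Polynomial.eval₂_mul,
        Polynomial.eval₂_C]
      simp
    rw [hA, hq]
    linear_combination hg0 + t * hg1 + q * t ^ 2 * hcn +
      (d * t + (p : ℤ_[p]) ^ b * q * t ^ 2) * hl
  obtain ⟨r, hr⟩ := hgx
  have hs1 : ‖s‖ ≤ 1 := by
    have h3 : ‖s‖ ^ 2 ≤ 1 := by
      rw [← norm_pow, hs]
      exact PadicInt.norm_le_one _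
    exact (sq_le_one_iff₀ (norm_nonneg _)).mp h3
  obtain ⟨S, rfl⟩ : ∃ S : ℤ_[p], (S : ℚ_[p]) = s := ⟨⟨s, hs1⟩, rfl⟩
  have hS : S ^ 2 = (p : ℤ_[p]) ^ k * ((u : ℤ_[p]) + (p : ℤ_[p]) ^ (lam - k) * r) := by
    rw [← hr]
    apply Subtype.coe_injective
    simpa using hs
  have hlk : lam - k ≠ 0 := by omega
  have hU : ¬ (p : ℤ_[p]) ∣ (u : ℤ_[p]) + (p : ℤ_[p]) ^ (lam - k) * r := by
    intro h4
    have h5 : (p : ℤ_[p]) ∣ (u : ℤ_[p]) :=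
      (dvd_add_left ((dvd_pow_self _ hlk).mul_right r)).mp h4
    apply hup
    have h6 := (PadicInt.pow_p_dvd_int_iff 1 u).mp (by simpa using h5)
    simpa using h6
  have hS0 : S ≠ 0 := by
    rintro rfl
    apply hU
    have h7 : (u : ℤ_[p]) + (p : ℤ_[p]) ^ (lam - k) * r = 0 := by
      rcases mul_eq_zero.mp (hS.symm.trans (by ring)) with h8 | h8
      · exact absurd h8 (pow_ne_zero _ hpz)
      · exact h8
    rw [h7]
    exact dvd_zero _
  have hspec := PadicInt.unitCoeff_spec hS0
  set j := S.valuation with hj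
  set v : ℤ_[p] := (PadicInt.unitCoeff hS0 : ℤ_[p]) with hv
  have hvu : IsUnit v := (PadicInt.unitCoeff hS0).isUnit
  have hprime : Prime (p : ℤ_[p]) := PadicInt.prime_p
  have hvp : ¬ (p : ℤ_[p]) ∣ v ^ 2 := fun h9 =>
    hprime.not_isUnit (isUnit_of_dvd_unit h9 (hvu.pow 2))
  have hmain : (p : ℤ_[p]) ^ (2 * j) * v ^ 2
      = (p : ℤ_[p]) ^ k * ((u : ℤ_[p]) + (p : ℤ_[p]) ^ (lam - k) * r) := by
    rw [← hS, hspec]; ring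
  have hjk : 2 * j = k := by
    rcases lt_trichotomy (2 * j) k with h9 | h9 | h9
    · exfalso
      obtain ⟨i, hi⟩ := Nat.exists_eq_add_of_lt h9
      apply hvp
      have hki : (p : ℤ_[p]) ^ k = (p : ℤ_[p]) ^ (2 * j) * ((p : ℤ_[p]) ^ i * p) := by
        rw [hi]; ring
      rw [hki, mul_assoc] at hmain
      rw [mul_left_cancel₀ (pow_ne_zero _ hpz) hmain]
      exact (dvd_mul_left _ _).mul_right _
    · exact h9
    · exfalso
      obtain ⟨i, hi⟩ := Nat.exists_eq_add_of_lt h9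
      apply hU
      rw [hi, pow_succ, pow_add, mul_assoc, mul_assoc] at hmain
      rw [← mul_left_cancel₀ (pow_ne_zero _ hpz) hmain]
      exact (dvd_mul_right _ _).mul_left _
  rcases hcond with hodd | ⟨-, hno⟩
  · rw [← hjk] at hodd
    exact (Nat.not_odd_iff_even.mpr (even_two_mul j)) hodd
  · rw [hjk] at hmain
    have hv2 := mul_left_cancel₀ (pow_ne_zero _ hpz) hmain
    apply hno
    refine ⟨(v.appr (lam - k) : ℤ), ?_⟩
    have ha := PadicInt.appr_spec (lam - k) v
    rw [Ideal.mem_span_singleton] at ha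
    obtain ⟨a, ha⟩ := ha
    have h10 := (PadicInt.pow_p_dvd_int_iff (p := p) (lam - k)
      ((v.appr (lam - k) : ℤ) ^ 2 - u)).mp
    have h11 : (p : ℤ_[p]) ^ (lam - k) ∣
        (((v.appr (lam - k) : ℤ) ^ 2 - u : ℤ) : ℤ_[p]) := by
      refine ⟨r - a * (v + (v.appr (lam - k) : ℤ_[p])), ?_⟩
      push_cast
      linear_combination hv2 - (v + (v.appr (lam - k) : ℤ_[p])) * ha
    exact_mod_cast h10 h11
end

section
/- Let K be a number field with ring of integers \mathcal{O}, let p be a rational prime, and let \mathfrak{p} be a nonzero prime ideal of \mathcal{O} lying above p with ramification index e = v_\mathfrak{p}(p); let \pi \in \mathcal{O} be an element with v_\mathfrak{p}(\pi) = 1. Let g = \sum_i a_i x^i be a nonzero polynomial with coefficients in \mathcal{O}, let x_0 be an integer with g(x_0) \neq 0, and let n \geq 1 be an integer. Let c = min_i v_\mathfrak{p}(a_i) (minimum over indices with a_i \neq 0), let m = v_\mathfrak{p}(g'(x_0)) (with m = +\infty if g'(x_0) = 0), let \lambda = min(m + ne, c + 2ne), and let k = v_\mathfrak{p}(g(x_0)).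 Suppose k < \lambda. If either (i) k is odd, or (ii) k is even and the image of g(x_0)\pi^{-k} in \mathcal{O}_\mathfrak{p}/\mathfrak{p}^{\lambda - k} (where \mathcal{O}_\mathfrak{p} is the ring of integers of the completion K_\mathfrak{p}) is not the square of an element of \mathcal{O}_\mathfrak{p}/\mathfrak{p}^{\lambda - k}, then for every x \in x_0 + p^n \mathbb{Z}_p \subset \mathcal{O}_\mathfrak{p}, g(x) is not a square in K_\mathfrak{p}. -/
open Polynomial IsDedekindDomain NumberField

lemma taylor_aux {R : Type*} [CommRing R] (I : Ideal R) (f : R[X]) (hf : ∀ i, f.coeff i ∈ I)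
    (x y : R) : ∃ q ∈ I, f.eval (x + y) = f.eval x + f.derivative.eval x * y + q * y ^ 2 := by
  refine ⟨f.sum fun e a => a * (powAddExpansion x y e).val, ?_, ?_⟩
  · exact Submodule.sum_mem _ fun i _ => I.mul_mem_right _ (hf i)
  · rw [eval_eq_sum, eval_eq_sum, derivative_eval]
    simp only [Polynomial.sum_def, Finset.sum_mul, ← Finset.sum_add_distrib]
    refine Finset.sum_congr rfl fun i _ => ?_
    refine (congrArg (f.coeff i * ·) (powAddExpansion x y i).property).trans ?_
    ring

section aux
variable {K : Type} [Field K] [NumberField K] (v : HeightOneSpectrum (𝓞 K))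

lemma ball_mem_nhds_aux (z : v.adicCompletion K) (N : ℕ) :
    {y : v.adicCompletion K | Valued.v (y - z) ≤ WithZero.exp (-(N : ℤ))} ∈ nhds z := by
  obtain ⟨a, ha⟩ := v.valuedAdicCompletion_surjective K (WithZero.exp (-(N : ℤ)))
  have ha0 : (Valued.v.restrict a) ≠ 0 := by
    intro h
    rw [Valuation.restrict_eq_zero_iff] at h
    rw [h] at ha
    exact WithZero.exp_ne_zero ha.symm
  rw [Valued.mem_nhds]
  refine ⟨Units.mk0 _ ha0, fun y hy => ?_⟩
  simp only [Units.val_mk0, Set.mem_ofPred_eq, Valuation.restrict_lt_iff] at hy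
  rw [ha] at hy
  exact hy.le

lemma val_aux (r : 𝓞 K) (N : ℕ) :
    Valued.v (algebraMap K (v.adicCompletion K) (algebraMap (𝓞 K) K r)) ≤ WithZero.exp (-(N : ℤ)) ↔
      r ∈ v.asIdeal ^ N := by
  rw [← v.intValuation_le_pow_iff_mem, ← v.valuation_of_algebraMap (K := K)]
  have := HeightOneSpectrum.valuedAdicCompletion_eq_valuation' v (algebraMap (𝓞 K) K r)
  rw [← this]
  rfl

lemma val_eq_aux (r : 𝓞 K) (N : ℕ) (h1 : r ∈ v.asIdeal ^ N) (h2 : r ∉ v.asIdeal ^ (N + 1)) :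
    Valued.v (algebraMap K (v.adicCompletion K) (algebraMap (𝓞 K) K r)) =
      WithZero.exp (-(N : ℤ)) := by
  rw [← val_aux (K := K)] at h1 h2
  refine le_antisymm h1 ?_
  by_contra h
  push Not at h h2
  generalize Valued.v (algebraMap K (v.adicCompletion K) (algebraMap (𝓞 K) K r)) = t at *
  have ht : t ≠ 0 := ne_zero_of_lt h2
  obtain ⟨j, rfl⟩ : ∃ j : ℤ, t = WithZero.exp j := ⟨WithZero.log t, (WithZero.exp_log ht).symm⟩
  rw [WithZero.exp_lt_exp] at h h2
  push_cast at h2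
  lia

lemma approx_aux (u : v.adicCompletion K) (hu : Valued.v u ≤ 1) (N : ℕ) :
    ∃ w : 𝓞 K, Valued.v (u - algebraMap K (v.adicCompletion K) (algebraMap (𝓞 K) K w)) ≤
      WithZero.exp (-(N : ℤ)) := by
  obtain ⟨_, hy, y, rfl⟩ := mem_closure_iff_nhds.1 (v.denseRange_algebraMap K u) _
    (ball_mem_nhds_aux v u N)
  rw [Set.mem_ofPred_eq, Valuation.map_sub_swap] at hy
  have hN : WithZero.exp (-(N : ℤ)) ≤ 1 := by
    rw [← WithZero.exp_zero, WithZero.exp_le_exp]; lia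
  have hy1 : Valued.v (algebraMap K (v.adicCompletion K) y) ≤ 1 := by
    have : algebraMap K (v.adicCompletion K) y =
      u - (u - algebraMap K (v.adicCompletion K) y) := by ring
    rw [this]
    exact Valuation.map_sub_le _ hu (hy.trans hN)
  have key : ∀ k : K, Valued.v (algebraMap K (v.adicCompletion K) k) = v.valuation K k :=
    fun k => HeightOneSpectrum.valuedAdicCompletion_eq_valuation' v k
  rw [key] at hy1
  obtain ⟨w, hw⟩ := v.exists_valuation_sub_lt_of_integer hy1
    (Units.mk0 (WithZero.exp (-(N : ℤ))) WithZero.exp_ne_zero)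
  refine ⟨w, ?_⟩
  rw [← key, map_sub, Units.val_mk0, Valuation.map_sub_swap] at hw
  have : u - algebraMap K (v.adicCompletion K) (algebraMap (𝓞 K) K w) =
    (u - algebraMap K (v.adicCompletion K) y) + (algebraMap K (v.adicCompletion K) y -
      algebraMap K (v.adicCompletion K) (algebraMap (𝓞 K) K w)) := by ring
  rw [this]
  exact Valuation.map_add_le _ hy hw.le

end aux

/-- Lemma 3.4 (criterion for `g(x)` not being a square in the completion `K_𝔭`
on a residue disc): let `K` be a number field with ring of integers `𝓞`,
`𝔭` a nonzero prime of `𝓞` above the rational prime `p`, with ramification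
index `e = v_𝔭(p)`, and `π` a uniformizer (`v_𝔭(π) = 1`).  Let `g ∈ 𝓞[x]`
be nonzero, `x₀ ∈ ℤ` with `g(x₀) ≠ 0`, `n ≥ 1`,
`c = min_i v_𝔭(aᵢ)` over the nonzero coefficients of `g`,
`m = v_𝔭(g'(x₀))` (`= ∞` if `g'(x₀) = 0`), `λ = min(m + ne, c + 2ne)` and
`k = v_𝔭(g(x₀))`.  If `k < λ` and either `k` is odd, or `k` is even and
`g(x₀)·π⁻ᵏ` is not a square in `𝓞_𝔭/𝔭^(λ-k)` (equivalently, there is no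
`w ∈ 𝓞` with `w²·πᵏ ≡ g(x₀) mod 𝔭^λ`), then `g(x)` is not a square in `K_𝔭`
for every `x ∈ x₀ + pⁿ ℤ_p ⊂ 𝓞_𝔭` (the disc being the closure in `K_𝔭` of
`{x₀ + pⁿ t : t ∈ ℤ}`). -/
theorem not_square_on_residue_disc_completion
    (K : Type) [Field K] [NumberField K]
    (v : HeightOneSpectrum (𝓞 K))
    (p : ℕ) (hp : p.Prime) (hpv : (p : 𝓞 K) ∈ v.asIdeal)
    (e : ℕ) (he1 : (p : 𝓞 K) ∈ v.asIdeal ^ e) (he2 : (p : 𝓞 K) ∉ v.asIdeal ^ (e + 1))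
    (π : 𝓞 K) (hπ1 : π ∈ v.asIdeal) (hπ2 : π ∉ v.asIdeal ^ 2)
    (g : Polynomial (𝓞 K)) (hg : g ≠ 0)
    (x₀ : ℤ) (hgx₀ : g.eval (x₀ : 𝓞 K) ≠ 0)
    (n : ℕ) (hn : 1 ≤ n)
    (c : ℕ) (hc1 : ∀ i, g.coeff i ∈ v.asIdeal ^ c)
    (hc2 : ∃ i, g.coeff i ∉ v.asIdeal ^ (c + 1))
    (m : ℕ∞)
    (hm : (m = ⊤ ∧ (Polynomial.derivative g).eval (x₀ : 𝓞 K) = 0) ∨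
      (∃ m₀ : ℕ, m = (m₀ : ℕ∞) ∧
        (Polynomial.derivative g).eval (x₀ : 𝓞 K) ∈ v.asIdeal ^ m₀ ∧
        (Polynomial.derivative g).eval (x₀ : 𝓞 K) ∉ v.asIdeal ^ (m₀ + 1)))
    (lam : ℕ)
    (hlam : (lam : ℕ∞) = min (m + (n * e : ℕ)) ((c : ℕ∞) + (2 * n * e : ℕ)))
    (k : ℕ) (hk1 : g.eval (x₀ : 𝓞 K) ∈ v.asIdeal ^ k)
    (hk2 : g.eval (x₀ : 𝓞 K) ∉ v.asIdeal ^ (k + 1))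
    (hklt : k < lam)
    (hcond : Odd k ∨
      (Even k ∧ ¬ ∃ w : 𝓞 K, w ^ 2 * π ^ k - g.eval (x₀ : 𝓞 K) ∈ v.asIdeal ^ lam)) :
    ∀ x : v.adicCompletion K,
      x ∈ closure {y : v.adicCompletion K |
          ∃ t : ℤ, y = algebraMap K (v.adicCompletion K) ((x₀ : K) + (p : K) ^ n * (t : K))} →
      ¬ ∃ s : v.adicCompletion K,
          s ^ 2 = Polynomial.aeval x (g.map (algebraMap (𝓞 K) K)) := by
  rintro x hx ⟨s, hs⟩
  have hev : ∀ r : 𝓞 K, Polynomial.aeval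
      (algebraMap K (v.adicCompletion K) (algebraMap (𝓞 K) K r)) (g.map (algebraMap (𝓞 K) K)) =
      algebraMap K (v.adicCompletion K) (algebraMap (𝓞 K) K (g.eval r)) := by
    intro r
    rw [Polynomial.aeval_algebraMap_apply, Polynomial.aeval_def, Polynomial.eval₂_map]
    simp [Polynomial.eval₂_at_apply]
  -- Taylor expansion on the disc
  have htay : ∀ t : ℤ, g.eval ((x₀ : 𝓞 K) + (p : 𝓞 K) ^ n * (t : 𝓞 K)) - g.eval (x₀ : 𝓞 K) ∈
      v.asIdeal ^ lam := by
    intro t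
    obtain ⟨q, hq, h⟩ := taylor_aux (v.asIdeal ^ c) g hc1 (x₀ : 𝓞 K) ((p : 𝓞 K) ^ n * (t : 𝓞 K))
    have hy : (p : 𝓞 K) ^ n * (t : 𝓞 K) ∈ v.asIdeal ^ (n * e) := by
      apply Ideal.mul_mem_right
      rw [mul_comm, pow_mul]
      exact Ideal.pow_mem_pow he1 n
    have h1 : (lam : ℕ∞) ≤ m + (n * e : ℕ) := hlam ▸ min_le_left _ _
    have h2 : (lam : ℕ∞) ≤ (c : ℕ∞) + (2 * n * e : ℕ) := hlam ▸ min_le_right _ _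
    have h2' : lam ≤ c + (n * e) * 2 := by
      have : lam ≤ c + 2 * n * e := by exact_mod_cast h2
      linarith
    rw [h, add_assoc, add_sub_cancel_left]
    apply Ideal.add_mem
    · rcases hm with ⟨-, h0⟩ | ⟨m₀, rfl, hm1, -⟩
      · simp [h0]
      · have h1' : lam ≤ m₀ + n * e := by exact_mod_cast h1
        apply Ideal.pow_le_pow_right h1'
        rw [pow_add]
        exact Ideal.mul_mem_mul hm1 hy
    · apply Ideal.pow_le_pow_right h2'
      rw [pow_add, pow_mul]
      exact Ideal.mul_mem_mul hq (Ideal.pow_mem_pow hy 2)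
  -- `s ^ 2` is close to `g x₀`
  have hcont : Continuous fun y : v.adicCompletion K =>
      Polynomial.aeval y (g.map (algebraMap (𝓞 K) K)) := Polynomial.continuous_aeval _
  obtain ⟨_, hy, t, rfl⟩ := mem_closure_iff_nhds.1 hx _
    (hcont.continuousAt.preimage_mem_nhds (ball_mem_nhds_aux v _ lam))
  rw [Set.mem_preimage, Set.mem_ofPred_eq, ← hs] at hy
  have hcast : ((x₀ : K) + (p : K) ^ n * (t : K)) =
      algebraMap (𝓞 K) K ((x₀ : 𝓞 K) + (p : 𝓞 K) ^ n * (t : 𝓞 K)) := by simp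
  rw [hcast, hev, Valuation.map_sub_swap] at hy
  have hst := (val_aux (K := K) v _ lam).2 (htay t)
  rw [map_sub, map_sub] at hst
  have hclose := Valuation.map_add_le _ hy hst
  rw [sub_add_sub_cancel] at hclose
  have hgk := val_eq_aux v _ k hk1 hk2
  have hπ := val_eq_aux v π 1 (by simpa using hπ1) hπ2
  have hvs : Valued.v (s ^ 2) = WithZero.exp (-(k : ℤ)) := by
    rw [← hgk]
    apply Valuation.map_eq_of_sub_lt
    rw [hgk]
    refine hclose.trans_lt ?_
    rw [WithZero.exp_lt_exp]
    lia
  rw [map_pow] at hvs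
  have hs0 : Valued.v s ≠ 0 := by
    intro h
    rw [h] at hvs
    rw [zero_pow two_ne_zero] at hvs
    exact WithZero.exp_ne_zero hvs.symm
  obtain ⟨j, hj⟩ : ∃ j : ℤ, Valued.v s = WithZero.exp j :=
    ⟨WithZero.log (Valued.v s), (WithZero.exp_log hs0).symm⟩
  rw [hj, ← WithZero.exp_nsmul, WithZero.exp_inj] at hvs
  have hjk : 2 * j = -(k : ℤ) := by simpa using hvs
  rcases hcond with hodd | ⟨heven, hno⟩
  · obtain ⟨l, hl⟩ := hodd
    lia
  obtain ⟨l, hl⟩ := heven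
  have hjl : j = -(l : ℤ) := by lia
  apply hno
  set P := algebraMap K (v.adicCompletion K) (algebraMap (𝓞 K) K π) with hP
  have hPl : Valued.v (P ^ l) = WithZero.exp j := by
    rw [map_pow, hπ, ← WithZero.exp_nsmul, hjl]
    simp
  have hP0 : P ^ l ≠ 0 := by
    intro h
    rw [h, map_zero] at hPl
    exact WithZero.exp_ne_zero hPl.symm
  have hu : Valued.v (s / P ^ l) = 1 := by
    rw [map_div₀, hPl, hj, div_self WithZero.exp_ne_zero]
  obtain ⟨w, hw⟩ := approx_aux v (s / P ^ l) hu.le lam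
  refine ⟨w, ?_⟩
  rw [← val_aux (K := K)]
  set W := algebraMap K (v.adicCompletion K) (algebraMap (𝓞 K) K w) with hW
  have hW1 : Valued.v W ≤ 1 := by
    have := (val_aux (K := K) v w 0).2 (by simp)
    simpa using this
  have hP1 : Valued.v P ≤ 1 := by
    rw [hπ, ← WithZero.exp_zero, WithZero.exp_le_exp]
    simp
  have hid : algebraMap K (v.adicCompletion K)
      (algebraMap (𝓞 K) K (w ^ 2 * π ^ k - g.eval (x₀ : 𝓞 K))) =
      (s ^ 2 - algebraMap K (v.adicCompletion K) (algebraMap (𝓞 K) K (g.eval (x₀ : 𝓞 K)))) -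
      P ^ k * ((s / P ^ l + W) * (s / P ^ l - W)) := by
    have hsu : s = (s / P ^ l) * P ^ l := by field_simp
    generalize s / P ^ l = u at *
    simp only [map_sub, map_mul, map_pow, ← hP, ← hW]
    rw [hsu, hl]
    ring
  rw [hid]
  refine Valuation.map_sub_le _ hclose ?_
  rw [map_mul, map_mul, map_pow]
  calc _ ≤ 1 * (1 * WithZero.exp (-(lam : ℤ))) := by
        gcongr
        · exact pow_le_one₀ zero_le hP1
        · exact Valuation.map_add_le _ hu.le hW1
    _ = _ := by simp
end

section
/- The only rational solutions (X, Y) of the equation Y^2 = X^5 + 20736 are (X, Y) = (0, 144) and (X, Y) = (0, -144). -/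
/-- The ring `ℤ[φ]` with `φ ^ 2 = 1 + φ`. -/
abbrev Zphi := QuadraticAlgebra ℤ 1 1

namespace Zphi

theorem norm_val (x : Zphi) : x.norm = x.re ^ 2 + x.re * x.im - x.im ^ 2 := by
  rw [QuadraticAlgebra.norm_def]; ring

theorem norm_form_eq_zero {a b : ℤ} (h : a ^ 2 + a * b - b ^ 2 = 0) : a = 0 ∧ b = 0 := by
  have h5 : (2 * a + b) * (2 * a + b) = 5 * (b * b) := by linarith
  by_cases hb : b = 0
  · subst hb
    refine ⟨?_, rfl⟩
    have : a ^ 2 = 0 := by linarith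
    exact pow_eq_zero_iff (two_ne_zero) |>.1 this
  · exfalso
    have hirr : Irrational (√(5 : ℕ)) := Nat.Prime.irrational_sqrt (by norm_num)
    apply hirr
    refine ⟨|((2 * a + b : ℤ) : ℚ) / b|, ?_⟩
    have hb' : (b : ℝ) ≠ 0 := by exact_mod_cast hb
    have h5' : ((2 * a + b : ℤ) : ℝ) * (2 * a + b : ℤ) = 5 * (b * b) := by exact_mod_cast h5
    push_cast
    rw [← Real.sqrt_sq_eq_abs]
    congr 1
    push_cast at h5'
    field_simp
    linarith

theorem norm_eq_zero {x : Zphi} (h : x.norm = 0) : x = 0 := by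
  rw [norm_val] at h
  obtain ⟨h1, h2⟩ := norm_form_eq_zero h
  ext <;> simpa

noncomputable def quo (x y : Zphi) : Zphi :=
  ⟨round (((x * star y).re : ℚ) / y.norm), round (((x * star y).im : ℚ) / y.norm)⟩

theorem norm_mod_lt (x : Zphi) {y : Zphi} (hy : y ≠ 0) :
    (x - y * quo x y).norm.natAbs < y.norm.natAbs := by
  have hn : y.norm ≠ 0 := fun h => hy (norm_eq_zero h)
  have hn' : (y.norm : ℚ) ≠ 0 := by exact_mod_cast hn
  set r := x - y * quo x y with hr
  have hre : (r * star y).re = (x * star y).re - y.norm * (quo x y).re := by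
    simp [hr, QuadraticAlgebra.norm_def]; ring
  have him : (r * star y).im = (x * star y).im - y.norm * (quo x y).im := by
    simp [hr, QuadraticAlgebra.norm_def]; ring
  have hN : r.norm * y.norm = (r * star y).norm := by
    rw [map_mul, QuadraticAlgebra.norm_star]
  have key : ∀ A : ℤ, |((A - y.norm * round ((A : ℚ) / y.norm) : ℤ) : ℚ)| ≤ |(y.norm : ℚ)| / 2 := by
    intro A
    have := abs_sub_round ((A : ℚ) / y.norm)
    have e : ((A - y.norm * round ((A : ℚ) / y.norm) : ℤ) : ℚ)
      = y.norm * ((A : ℚ) / y.norm - round ((A : ℚ) / y.norm)) := by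
      push_cast; field_simp
    rw [e, abs_mul]
    nlinarith [abs_nonneg (y.norm : ℚ)]
  have k1 := key (x * star y).re
  have k2 := key (x * star y).im
  have e1 : (quo x y).re = round (((x * star y).re : ℚ) / y.norm) := rfl
  have e2 : (quo x y).im = round (((x * star y).im : ℚ) / y.norm) := rfl
  rw [← e1, ← hre] at k1
  rw [← e2, ← him] at k2
  rw [norm_val (r * star y)] at hN
  generalize (r * star y).re = e at *
  generalize (r * star y).im = f at *
  have hNq : |(r.norm : ℚ)| * |(y.norm : ℚ)| = |(e : ℚ) ^ 2 + e * f - f ^ 2| := by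
    rw [← abs_mul]; exact_mod_cast congrArg (fun z : ℤ => |(z : ℚ)|) hN
  have hpos : 0 < |(y.norm : ℚ)| := abs_pos.2 hn'
  generalize hn2 : |(y.norm : ℚ)| = n at *
  have b1 : |(e : ℚ) ^ 2 + e * f - f ^ 2| ≤ 3 / 4 * n ^ 2 := by
    rw [abs_le] at k1 k2 ⊢
    constructor <;> nlinarith [sq_nonneg ((e : ℚ) + f), sq_nonneg ((e : ℚ) - f)]
  have : |(r.norm : ℚ)| < n := by
    by_contra! hc
    nlinarith
  rw [← hn2] at this
  zify
  exact_mod_cast this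

noncomputable instance : EuclideanDomain Zphi :=
  { (inferInstance : CommRing Zphi), (inferInstance : Nontrivial Zphi) with
    quotient := quo
    quotient_zero := by
      intro a
      ext <;> simp [quo]
    remainder := fun x y => x - y * quo x y
    quotient_mul_add_remainder_eq := by intro a b; ring
    r := fun x y => x.norm.natAbs < y.norm.natAbs
    r_wellFounded := (measure fun x : Zphi => x.norm.natAbs).wf
    remainder_lt := fun a b hb => norm_mod_lt a hb
    mul_left_not_lt := by
      intro a b hb
      rw [map_mul, Int.natAbs_mul, not_lt]
      apply Nat.le_mul_of_pos_right
      rw [Int.natAbs_pos]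
      exact fun h => hb (norm_eq_zero h) }

theorem pow_five (a b : ℤ) : (⟨a, b⟩ : Zphi) ^ 5 =
    ⟨a ^ 5 + 10 * a ^ 3 * b ^ 2 + 10 * a ^ 2 * b ^ 3 + 10 * a * b ^ 4 + 3 * b ^ 5,
      5 * b * (a ^ 4 + 2 * a ^ 3 * b + 4 * a ^ 2 * b ^ 2 + 3 * a * b ^ 3 + b ^ 4)⟩ := by
  ext <;> simp [pow_succ] <;> ring

/-- The units modulo fifth powers. -/
def Good (e : Zphi) : Prop := ∃ (k : Fin 5) (d : Zphi), e = (⟨0, 1⟩ : Zphi) ^ (k : ℕ) * d ^ 5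

theorem Good.mul_phi {e : Zphi} (h : Good e) : Good (⟨0, 1⟩ * e) := by
  obtain ⟨k, d, rfl⟩ := h
  fin_cases k
  · exact ⟨1, d, by simp⟩
  · exact ⟨2, d, by simp; ring⟩
  · exact ⟨3, d, by simp; ring⟩
  · exact ⟨4, d, by simp; ring⟩
  · exact ⟨0, ⟨0, 1⟩ * d, by simp; ring⟩

theorem Good.neg {e : Zphi} (h : Good e) : Good (-e) := by
  obtain ⟨k, d, rfl⟩ := h
  exact ⟨k, -d, by ring⟩

theorem good_one : Good 1 := ⟨0, 1, by simp⟩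

theorem Good.pow_phi {e : Zphi} (h : Good e) (n : ℕ) : Good (⟨0, 1⟩ ^ n * e) := by
  induction n with
  | zero => simpa
  | succ n ih => rw [pow_succ', mul_assoc]; exact ih.mul_phi

theorem phi_inv : (⟨0, 1⟩ : Zphi) * ⟨-1, 1⟩ = 1 := by
  ext <;> simp [QuadraticAlgebra.re_one, QuadraticAlgebra.im_one]

theorem Good.of_mul_phi {e : Zphi} (h : Good (⟨0, 1⟩ * e)) : Good e := by
  obtain ⟨k, d, hk⟩ := h.pow_phi 4
  refine ⟨k, ⟨-1, 1⟩ * d, ?_⟩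
  have h5 : (⟨0, 1⟩ : Zphi) ^ 5 * ⟨-1, 1⟩ ^ 5 = 1 := by rw [← mul_pow, phi_inv, one_pow]
  calc e = (⟨0, 1⟩ ^ 5 * ⟨-1, 1⟩ ^ 5) * e := by rw [h5, one_mul]
    _ = ⟨-1, 1⟩ ^ 5 * (⟨0, 1⟩ ^ 4 * (⟨0, 1⟩ * e)) := by ring
    _ = _ := by rw [hk]; ring

theorem good_nonneg (n : ℕ) : ∀ a b : ℤ, 0 ≤ a → 0 ≤ b → a + b ≤ n →
    (a ^ 2 + a * b - b ^ 2 = 1 ∨ a ^ 2 + a * b - b ^ 2 = -1) → Good ⟨a, b⟩ := by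
  induction n with
  | zero =>
    intro a b ha hb hab h
    have : a = 0 := by push_cast at hab; omega
    have : b = 0 := by push_cast at hab; omega
    subst a b; simp at h
  | succ n ih =>
    intro a b ha hb hab h
    push_cast at hab
    rcases eq_or_lt_of_le hb with rfl | hb
    · have : a = 1 := by rcases h with h | h <;> nlinarith
      subst this; exact good_one
    rcases eq_or_lt_of_le ha with rfl | ha
    · have : b = 1 := by rcases h with h | h <;> nlinarith
      subst this
      simpa using good_one.mul_phi
    have hle : a ≤ b := by
      by_contra! hc
      rcases h with h | h <;> nlinarith
    have := ih (b - a) a (by omega) ha.le (by omega) (by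
      rcases h with h | h
      · right; linarith
      · left; linarith)
    have h2 := this.mul_phi
    convert h2 using 1
    ext <;> simp

theorem good_mixed (n : ℕ) : ∀ a b : ℤ, 0 ≤ a → 0 ≤ b → a + b ≤ n →
    (a ^ 2 - a * b - b ^ 2 = 1 ∨ a ^ 2 - a * b - b ^ 2 = -1) → Good ⟨a, -b⟩ := by
  induction n with
  | zero =>
    intro a b ha hb hab h
    have : a = 0 := by push_cast at hab; omega
    have : b = 0 := by push_cast at hab; omega
    subst a b; simp at h
  | succ n ih =>
    intro a b ha hb hab h
    push_cast at hab
    rcases eq_or_lt_of_le hb with rfl | hb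
    · have : a = 1 := by rcases h with h | h <;> nlinarith
      subst this; exact good_one
    rcases eq_or_lt_of_le ha with rfl | ha
    · have : b = 1 := by rcases h with h | h <;> nlinarith
      subst this
      simpa [QuadraticAlgebra.neg_mk] using good_one.mul_phi.neg
    have hle : b ≤ a := by
      by_contra! hc
      rcases h with h | h <;> nlinarith
    have := ih b (a - b) hb.le (by omega) (by omega) (by
      rcases h with h | h
      · right; linarith
      · left; linarith)
    apply Good.of_mul_phi
    have h2 := this.neg
    convert h2 using 1
    ext <;> simp <;> ring

theorem good_of_isUnit {e : Zphi} (h : IsUnit e) : Good e := by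
  rw [QuadraticAlgebra.isUnit_iff_norm_isUnit, Int.isUnit_iff, norm_val] at h
  obtain ⟨a, b⟩ := e
  simp only at h
  rcases le_total 0 a with ha | ha <;> rcases le_total 0 b with hb | hb
  · exact good_nonneg (a + b).toNat a b ha hb (by omega) h
  · have := good_mixed (a - b).toNat a (-b) ha (by omega) (by omega) (by ring_nf at h ⊢; exact h)
    simpa using this
  · have := (good_mixed (b - a).toNat (-a) b (by omega) hb (by omega)
      (by ring_nf at h ⊢; exact h)).neg
    simpa [QuadraticAlgebra.neg_mk] using this
  · have := (good_nonneg (-a - b).toNat (-a) (-b) (by omega) (by omega) (by omega)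
      (by ring_nf at h ⊢; exact h)).neg
    simpa [QuadraticAlgebra.neg_mk] using this

/-- The key lemma: an element of `ℤ[φ]` whose norm is a fifth power prime to 5, and whose
coordinates are coprime with the second divisible by 5, is a fifth power. -/
theorem is_fifth_power {X Y s : ℤ} (hc : IsCoprime X Y) (hY : 5 ∣ Y) (hX : ¬ 5 ∣ X)
    (hs : X ^ 2 + X * Y - Y ^ 2 = s ^ 5) : ∃ c d : ℤ, (⟨X, Y⟩ : Zphi) = ⟨c, d⟩ ^ 5 := by
  have p5 : Prime (5 : ℤ) := by norm_num
  have hc5 : IsCoprime X 5 := (p5.coprime_iff_not_dvd.2 hX).symm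
  have hcN : IsCoprime (X ^ 2 + X * Y - Y ^ 2) (5 * Y ^ 2) := by
    obtain ⟨Z, rfl⟩ := hY
    have e : X ^ 2 + X * (5 * Z) - (5 * Z) ^ 2 = X ^ 2 + (5 * Z) * (X - 5 * Z) := by ring
    have h1 : IsCoprime (X ^ 2 + X * (5 * Z) - (5 * Z) ^ 2) (5 * Z) := by
      rw [e]; exact (hc.pow_left).add_mul_left_left _
    exact IsCoprime.mul_right (IsCoprime.of_mul_right_left h1) h1.pow_right
  set g : Zphi := ⟨X, Y⟩ with hg
  have hcast : ∀ n : ℤ, (n : Zphi) = ⟨n, 0⟩ := fun _ => rfl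
  have hgs : g * star g = ((X ^ 2 + X * Y - Y ^ 2 : ℤ) : Zphi) := by
    rw [hcast]; ext <;> simp [hg] <;> ring
  have hgd : (g - star g) ^ 2 = ((5 * Y ^ 2 : ℤ) : Zphi) := by
    rw [hcast]; ext <;> simp [hg, pow_two] <;> ring
  have hcop : IsCoprime g (star g) := by
    have h1 : IsCoprime (g * star g) ((g - star g) ^ 2) := by
      rw [hgs, hgd]; exact hcN.map (Int.castRingHom Zphi)
    have h2 : IsCoprime g (g - star g) :=
      (IsCoprime.of_mul_left_left h1).of_isCoprime_of_dvd_right (Dvd.intro_left _ (pow_succ _ 1).symm)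
    have := h2.neg_right.add_mul_left_right 1
    simpa using this
  have hpow : g * star g = ((s : ℤ) : Zphi) ^ 5 := by
    rw [hgs, hs]; push_cast; rfl
  classical
  let := EuclideanDomain.gcdMonoid Zphi
  obtain ⟨d, hd⟩ := exists_associated_pow_of_mul_eq_pow
    ((gcd_isUnit_iff g (star g)).2 hcop) hpow
  obtain ⟨u, hu⟩ := hd
  obtain ⟨k, d2, hk⟩ := good_of_isUnit u.isUnit
  have hfin : g = ⟨0, 1⟩ ^ (k : ℕ) * (d * d2) ^ 5 := by
    rw [← hu, hk]; ring
  generalize d * d2 = w at hfin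
  obtain ⟨c, d⟩ := w
  refine ⟨c, d, ?_⟩
  obtain ⟨R, S, hRS⟩ : ∃ R S : ℤ, (⟨c, d⟩ : Zphi) ^ 5 = ⟨R, 5 * S⟩ :=
    ⟨_, _, by rw [pow_five, mul_assoc 5 d]⟩
  rw [hRS] at hfin ⊢
  have hre := congrArg QuadraticAlgebra.re hfin
  have him := congrArg QuadraticAlgebra.im hfin
  fin_cases k
  · rw [hfin]; simp
  all_goals
    exfalso
    simp [pow_succ, hg] at hre him
    have h5R : 5 ∣ R := by omega
    apply hX
    omega
end Zphi

/-- The quartic form attached to the `φ`-coordinate of a fifth power. -/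
def quarticH (a b : ℤ) : ℤ := a ^ 4 + 2 * a ^ 3 * b + 4 * a ^ 2 * b ^ 2 + 3 * a * b ^ 3 + b ^ 4

theorem quarticH_not_two {a b : ℤ} (h : IsCoprime a b) : ¬ 2 ∣ quarticH a b := by
  intro hd
  have h0 : ((quarticH a b : ℤ) : ZMod 2) = 0 := (ZMod.intCast_zmod_eq_zero_iff_dvd _ 2).2 hd
  have key : ∀ a b : ZMod 2, a ^ 4 + 2 * a ^ 3 * b + 4 * a ^ 2 * b ^ 2 + 3 * a * b ^ 3 + b ^ 4 = 0 →
      a = 0 ∧ b = 0 := by decide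
  simp only [quarticH] at h0
  push_cast at h0
  obtain ⟨ha, hb⟩ := key _ _ h0
  have ha' := (ZMod.intCast_zmod_eq_zero_iff_dvd a 2).1 ha
  have hb' := (ZMod.intCast_zmod_eq_zero_iff_dvd b 2).1 hb
  have := h.isUnit_of_dvd' ha' hb'
  norm_num [Int.isUnit_iff] at this

theorem quarticH_not_three {a b : ℤ} (h : IsCoprime a b) : ¬ 3 ∣ quarticH a b := by
  intro hd
  have h0 : ((quarticH a b : ℤ) : ZMod 3) = 0 := (ZMod.intCast_zmod_eq_zero_iff_dvd _ 3).2 hd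
  have key : ∀ a b : ZMod 3, a ^ 4 + 2 * a ^ 3 * b + 4 * a ^ 2 * b ^ 2 + 3 * a * b ^ 3 + b ^ 4 = 0 →
      a = 0 ∧ b = 0 := by decide
  simp only [quarticH] at h0
  push_cast at h0
  obtain ⟨ha, hb⟩ := key _ _ h0
  have ha' := (ZMod.intCast_zmod_eq_zero_iff_dvd a 3).1 ha
  have hb' := (ZMod.intCast_zmod_eq_zero_iff_dvd b 3).1 hb
  have := h.isUnit_of_dvd' ha' hb'
  norm_num [Int.isUnit_iff] at this

theorem quarticH_not_five {c d : ℤ}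
    (h : ¬ 5 ∣ c ^ 5 + 10 * c ^ 3 * d ^ 2 + 10 * c ^ 2 * d ^ 3 + 10 * c * d ^ 4 + 3 * d ^ 5) :
    ¬ 5 ∣ quarticH c d := by
  intro hd
  apply h
  have h0 : ((quarticH c d : ℤ) : ZMod 5) = 0 := (ZMod.intCast_zmod_eq_zero_iff_dvd _ 5).2 hd
  have key : ∀ a b : ZMod 5, a ^ 4 + 2 * a ^ 3 * b + 4 * a ^ 2 * b ^ 2 + 3 * a * b ^ 3 + b ^ 4 = 0 →
      a ^ 5 + 10 * a ^ 3 * b ^ 2 + 10 * a ^ 2 * b ^ 3 + 10 * a * b ^ 4 + 3 * b ^ 5 = 0 := by decide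
  simp only [quarticH] at h0
  push_cast at h0
  have := key _ _ h0
  apply (ZMod.intCast_zmod_eq_zero_iff_dvd _ 5).1
  push_cast
  exact this

theorem coprime_thirty {h : ℤ} (h2 : ¬ 2 ∣ h) (h3 : ¬ 3 ∣ h) (h5 : ¬ 5 ∣ h) : IsCoprime h 30 := by
  have p2 : Prime (2 : ℤ) := Int.prime_two
  have p3 : Prime (3 : ℤ) := Int.prime_three
  have p5 : Prime (5 : ℤ) := by norm_num
  have e : (30 : ℤ) = 2 * 3 * 5 := by norm_num
  rw [e]
  exact (((p2.coprime_iff_not_dvd.2 h2).symm.mul_right (p3.coprime_iff_not_dvd.2 h3).symm).mul_right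
    (p5.coprime_iff_not_dvd.2 h5).symm)

theorem odd_five : Odd 5 := by decide

theorem descent_step {X Y s K w : ℤ} {j : ℕ} (hc : IsCoprime X Y) (hY : 25 ∣ Y) (hY0 : Y ≠ 0)
    (hX : ¬ 5 ∣ X) (hs : X ^ 2 + X * Y - Y ^ 2 = s ^ 5) (hK : K ∣ 30 ^ j) (hw : K * Y = w ^ 5) :
    ∃ c d t s' : ℤ, IsCoprime c d ∧ 5 ∣ d ∧ d ≠ 0 ∧ Y = 5 * d * quarticH c d ∧
      5 * K * d = t ^ 5 ∧ quarticH c d = s' ^ 5 := by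
  have p5 : Prime (5 : ℤ) := by norm_num
  obtain ⟨c, d, hcd⟩ := Zphi.is_fifth_power hc (dvd_trans (by norm_num) hY) hX hs
  rw [Zphi.pow_five] at hcd
  have hXe := congrArg QuadraticAlgebra.re hcd
  have hYe : Y = 5 * d * quarticH c d := congrArg QuadraticAlgebra.im hcd
  simp only at hXe
  have hcop : IsCoprime c d := by
    have h1 : IsCoprime X d := hc.of_isCoprime_of_dvd_right ⟨5 * quarticH c d, by rw [hYe]; ring⟩
    have e : X = c ^ 5 + d * (10 * c ^ 3 * d + 10 * c ^ 2 * d ^ 2 + 10 * c * d ^ 3 + 3 * d ^ 4) := by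
      rw [hXe]; ring
    rw [e, IsCoprime.add_mul_left_left_iff] at h1
    exact (IsCoprime.pow_left_iff (by norm_num)).1 h1
  have h5 : ¬ 5 ∣ quarticH c d := quarticH_not_five (by rwa [← hXe])
  have hd0 : d ≠ 0 := by
    rintro rfl
    apply hY0; rw [hYe]; ring
  have h5d : 5 ∣ d := by
    have : (5 : ℤ) ∣ d * quarticH c d := by
      rw [hYe, mul_assoc] at hY
      omega
    exact (p5.dvd_or_dvd this).resolve_right h5
  have hHd : IsCoprime (quarticH c d) d := by
    have e : quarticH c d = c ^ 4 + d * (2 * c ^ 3 + 4 * c ^ 2 * d + 3 * c * d ^ 2 + d ^ 3) := by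
      simp only [quarticH]; ring
    rw [e]
    exact hcop.pow_left.add_mul_left_left _
  have h30 := coprime_thirty (quarticH_not_two hcop) (quarticH_not_three hcop) h5
  have hHK : IsCoprime (quarticH c d) (5 * K * d) := by
    refine IsCoprime.mul_right (IsCoprime.mul_right ?_ ?_) hHd
    · exact h30.of_isCoprime_of_dvd_right (by norm_num)
    · exact (h30.pow_right (n := j)).of_isCoprime_of_dvd_right hK
  obtain ⟨⟨s', hs'⟩, ⟨t, ht⟩⟩ := Int.eq_pow_of_mul_eq_pow_odd hHK odd_five
    (show quarticH c d * (5 * K * d) = w ^ 5 by rw [← hw, hYe]; ring)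
  exact ⟨c, d, t, s', hcop, h5d, hd0, hYe, ht, hs'⟩

theorem descent (n : ℕ) : ∀ (a b K w s : ℤ) (j : ℕ), b.natAbs ≤ n → IsCoprime a b → 5 ∣ b → b ≠ 0 →
    K ∣ 30 ^ j → K * b = w ^ 5 → quarticH a b = s ^ 5 → False := by
  induction n with
  | zero =>
    intro a b K w s j hn _ _ hb0
    omega
  | succ n ih =>
    intro a b K w s j hn hc h5 hb0 hK hw hs
    have p5 : Prime (5 : ℤ) := by norm_num
    have e : a ^ 2 + a * b + b ^ 2 = a ^ 2 + b * (a + b) := by ring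
    have hXb : IsCoprime (a ^ 2 + a * b + b ^ 2) b := by
      rw [e]; exact hc.pow_left.add_mul_left_left _
    obtain ⟨c, d, t, s', hcop, h5d, hd0, hYe, ht, hs'⟩ := descent_step (X := a ^ 2 + a * b + b ^ 2)
      (Y := b ^ 2) (s := s) (K := K ^ 2) (w := w ^ 2) (j := 2 * j) hXb.pow_right
      (by have := pow_dvd_pow_of_dvd h5 2; norm_num at this; exact this) (pow_ne_zero 2 hb0)
      (fun h => by
        have := hXb.isUnit_of_dvd' h h5
        norm_num [Int.isUnit_iff] at this)
      (by rw [← hs]; simp only [quarticH]; ring)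
      (by rw [mul_comm, pow_mul]; exact pow_dvd_pow_of_dvd hK 2)
      (by rw [← mul_pow, hw]; ring)
    refine ih c d (5 * K ^ 2) t s' (2 * j + 1) ?_ hcop h5d hd0 ?_ ht hs'
    · have h16 : 16 * quarticH c d = (2 * c + d) ^ 4 + 10 * (2 * c + d) ^ 2 * d ^ 2 + 5 * d ^ 4 := by
        simp only [quarticH]; ring
      have hge : 5 * d ^ 4 ≤ 16 * quarticH c d := by
        rw [h16]
        have : 0 ≤ (2 * c + d) ^ 4 + 10 * (2 * c + d) ^ 2 * d ^ 2 := by positivity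
        linarith
      have hb2 : 0 < b ^ 2 := by positivity
      have hd4 : 0 < d ^ 4 := by positivity
      have hd : 0 < d := by
        by_contra! hneg
        nlinarith
      have h2 : d ^ 2 ≤ d ^ 5 := pow_le_pow_right₀ (by omega) (by norm_num)
      have h3 : d ^ 2 < b ^ 2 := by
        have : d * (5 * d ^ 4) ≤ d * (16 * quarticH c d) := mul_le_mul_of_nonneg_left hge hd.le
        nlinarith
      have := Int.natAbs_lt_iff_sq_lt.2 h3
      omega
    · rw [pow_succ 30, mul_comm]
      refine mul_dvd_mul ?_ (by norm_num : (5 : ℤ) ∣ 30)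
      rw [mul_comm 2 j, pow_mul]; exact pow_dvd_pow_of_dvd hK 2

theorem core {x y K z : ℤ} {j : ℕ} (hc : IsCoprime x y) (h0 : x + y ≠ 0) (hK : K ∣ 30 ^ j)
    (hz : K * (x ^ 5 + y ^ 5) = z ^ 5) (h5 : 3125 ∣ x ^ 5 + y ^ 5) : False := by
  have p5 : Prime (5 : ℤ) := by norm_num
  have hsum : 5 ∣ x + y := by
    have h1 : ((x ^ 5 + y ^ 5 : ℤ) : ZMod 5) = 0 :=
      (ZMod.intCast_zmod_eq_zero_iff_dvd _ 5).2 (dvd_trans (by norm_num) h5)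
    have key : ∀ a b : ZMod 5, a ^ 5 + b ^ 5 = 0 → a + b = 0 := by decide
    push_cast at h1
    apply (ZMod.intCast_zmod_eq_zero_iff_dvd _ 5).1
    push_cast
    exact key _ _ h1
  obtain ⟨r, hr⟩ := hsum
  obtain rfl : y = 5 * r - x := by linarith
  have hr0 : r ≠ 0 := by rintro rfl; apply h0; ring
  have hxr : IsCoprime x (5 * r) := by
    have := hc.add_mul_left_right 1
    simpa using this
  have hx5 : ¬ 5 ∣ x := fun h => by
    have := hxr.isUnit_of_dvd' h (Dvd.intro _ rfl)
    norm_num [Int.isUnit_iff] at this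
  set X := x ^ 2 - 5 * x * r + 10 * r ^ 2 with hX
  set E := X ^ 2 + X * (5 * r ^ 2) - (5 * r ^ 2) ^ 2 with hE
  have hfac : x ^ 5 + (5 * r - x) ^ 5 = 25 * (r * E) := by
    rw [hE, hX]; ring
  have hXr : IsCoprime X (5 * r) := by
    have e : X = x ^ 2 + (5 * r) * (2 * r - x) := by rw [hX]; ring
    rw [e]; exact hxr.pow_left.add_mul_left_left _
  have hEr : IsCoprime E (5 * r) := by
    have e : E = X ^ 2 + (5 * r) * (X * r - 5 * r ^ 3) := by rw [hE]; ring
    rw [e]; exact hXr.pow_left.add_mul_left_left _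
  have hX5 : ¬ 5 ∣ X := fun h => by
    have := hXr.isUnit_of_dvd' h (Dvd.intro _ rfl)
    norm_num [Int.isUnit_iff] at this
  have hE5 : ¬ 5 ∣ E := fun h => by
    have := hEr.isUnit_of_dvd' h (Dvd.intro _ rfl)
    norm_num [Int.isUnit_iff] at this
  have hE2 : ¬ 2 ∣ E := fun h => by
    have h1 : ((E : ℤ) : ZMod 2) = 0 := (ZMod.intCast_zmod_eq_zero_iff_dvd _ 2).2 h
    have key : ∀ x r : ZMod 2, (x ^ 2 - 5 * x * r + 10 * r ^ 2) ^ 2 +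
      (x ^ 2 - 5 * x * r + 10 * r ^ 2) * (5 * r ^ 2) - (5 * r ^ 2) ^ 2 = 0 → x = 0 ∧ r = 0 := by
      decide
    rw [hE, hX] at h1
    push_cast at h1
    obtain ⟨ha, hb⟩ := key _ _ h1
    have ha' := (ZMod.intCast_zmod_eq_zero_iff_dvd x 2).1 ha
    have hb' := (ZMod.intCast_zmod_eq_zero_iff_dvd r 2).1 hb
    have := hxr.isUnit_of_dvd' ha' (hb'.mul_left 5)
    norm_num [Int.isUnit_iff] at this
  have hE3 : ¬ 3 ∣ E := fun h => by
    have h1 : ((E : ℤ) : ZMod 3) = 0 := (ZMod.intCast_zmod_eq_zero_iff_dvd _ 3).2 h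
    have key : ∀ x r : ZMod 3, (x ^ 2 - 5 * x * r + 10 * r ^ 2) ^ 2 +
      (x ^ 2 - 5 * x * r + 10 * r ^ 2) * (5 * r ^ 2) - (5 * r ^ 2) ^ 2 = 0 → x = 0 ∧ r = 0 := by
      decide
    rw [hE, hX] at h1
    push_cast at h1
    obtain ⟨ha, hb⟩ := key _ _ h1
    have ha' := (ZMod.intCast_zmod_eq_zero_iff_dvd x 3).1 ha
    have hb' := (ZMod.intCast_zmod_eq_zero_iff_dvd r 3).1 hb
    have := hxr.isUnit_of_dvd' ha' (hb'.mul_left 5)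
    norm_num [Int.isUnit_iff] at this
  have h30 := coprime_thirty hE2 hE3 hE5
  have h5r : 5 ∣ r := by
    rw [hfac] at h5
    have : (5 : ℤ) ∣ r * E := by omega
    exact (p5.dvd_or_dvd this).resolve_right hE5
  have hEK : IsCoprime E (25 * K * r) := by
    refine IsCoprime.mul_right (IsCoprime.mul_right ?_ ?_) (IsCoprime.of_mul_right_right hEr)
    · exact (h30.pow_right (n := 2)).of_isCoprime_of_dvd_right (by norm_num)
    · exact (h30.pow_right (n := j)).of_isCoprime_of_dvd_right hK
  obtain ⟨⟨s, hs⟩, ⟨t, ht⟩⟩ := Int.eq_pow_of_mul_eq_pow_odd hEK odd_five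
    (show E * (25 * K * r) = z ^ 5 by rw [← hz, hfac]; ring)
  obtain ⟨c, d, t', s', hcop, h5d, hd0, -, ht', hs'⟩ := descent_step (X := X) (Y := 5 * r ^ 2)
    (s := s) (K := 5 ^ 4 * (25 * K) ^ 2) (w := 5 * t ^ 2) (j := 2 * j + 8)
    (by
      have := hXr.pow_right (n := 2)
      exact this.of_isCoprime_of_dvd_right ⟨5, by ring⟩)
    (by obtain ⟨q, rfl⟩ := h5r; exact ⟨5 * q ^ 2, by ring⟩)
    (by positivity) hX5 hs
    (by
      have e : (5 ^ 4 * (25 * K) ^ 2 : ℤ) = K ^ 2 * 5 ^ 8 := by ring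
      rw [e, pow_add, mul_comm 2 j, pow_mul]
      exact mul_dvd_mul (pow_dvd_pow_of_dvd hK 2) (pow_dvd_pow_of_dvd (by norm_num) 8))
    (by
      have : (25 * K * r) ^ 2 = (t ^ 5) ^ 2 := by rw [ht]
      calc _ = 5 ^ 5 * (25 * K * r) ^ 2 := by ring
        _ = _ := by rw [this]; ring)
  refine descent d.natAbs c d (5 * (5 ^ 4 * (25 * K) ^ 2)) t' s' (2 * j + 9) le_rfl hcop h5d hd0 ?_
    ht' hs'
  have e : (5 * (5 ^ 4 * (25 * K) ^ 2) : ℤ) = K ^ 2 * 5 ^ 9 := by ring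
  rw [e, pow_add, mul_comm 2 j, pow_mul]
  exact mul_dvd_mul (pow_dvd_pow_of_dvd hK 2) (pow_dvd_pow_of_dvd (by norm_num) 9)

theorem fifth_mod (x : ZMod 25) :
    x ^ 5 = 0 ∨ x ^ 5 = 1 ∨ x ^ 5 = -1 ∨ x ^ 5 = 7 ∨ x ^ 5 = -7 := by
  revert x; decide

theorem five_dvd_of {x : ℤ} (h : ((x : ℤ) : ZMod 25) ^ 5 = 0) : 5 ∣ x := by
  have h1 : ((x ^ 5 : ℤ) : ZMod 25) = 0 := by push_cast; exact h
  have h2 := (ZMod.intCast_zmod_eq_zero_iff_dvd _ 25).1 h1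
  have p5 : Prime (5 : ℤ) := by norm_num
  exact p5.dvd_of_dvd_pow (dvd_trans (by norm_num) h2)

theorem no_three {x y z : ℤ} (hc : IsCoprime x y) (hz : z ≠ 0) (h : x ^ 5 + y ^ 5 = 3 * z ^ 5) :
    False := by
  have h5 : 5 ∣ z := by
    apply five_dvd_of
    have h' : (x : ZMod 25) ^ 5 + (y : ZMod 25) ^ 5 = 3 * (z : ZMod 25) ^ 5 := by
      exact_mod_cast congrArg (fun n : ℤ => (n : ZMod 25)) h
    rcases fifth_mod z with hz | hz | hz | hz | hz
    · exact hz
    all_goals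
      exfalso
      rcases fifth_mod x with hx | hx | hx | hx | hx <;>
      rcases fifth_mod y with hy | hy | hy | hy | hy <;>
      · rw [hx, hy, hz] at h'
        revert h'
        decide
  refine core (K := 81) (z := 3 * z) (j := 4) hc ?_ (by norm_num) (by rw [h]; ring) ?_
  · intro h0
    obtain rfl : y = -x := by linarith
    apply hz
    have : z ^ 5 = 0 := by linarith [h, show x ^ 5 + (-x) ^ 5 = 0 by ring]
    exact pow_eq_zero_iff (by norm_num) |>.1 this
  · rw [h]; exact (pow_dvd_pow_of_dvd h5 5).mul_left 3

theorem no_nine {x y z : ℤ} (hc : IsCoprime x y) (hz : z ≠ 0) (h : x ^ 5 + y ^ 5 = 9 * z ^ 5) :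
    False := by
  have h5 : 5 ∣ z := by
    apply five_dvd_of
    have h' : (x : ZMod 25) ^ 5 + (y : ZMod 25) ^ 5 = 9 * (z : ZMod 25) ^ 5 := by
      exact_mod_cast congrArg (fun n : ℤ => (n : ZMod 25)) h
    rcases fifth_mod z with hz | hz | hz | hz | hz
    · exact hz
    all_goals
      exfalso
      rcases fifth_mod x with hx | hx | hx | hx | hx <;>
      rcases fifth_mod y with hy | hy | hy | hy | hy <;>
      · rw [hx, hy, hz] at h'
        revert h'
        decide
  refine core (K := 27) (z := 3 * z) (j := 3) hc ?_ (by norm_num) (by rw [h]; ring) ?_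
  · intro h0
    obtain rfl : y = -x := by linarith
    apply hz
    have : z ^ 5 = 0 := by linarith [h, show x ^ 5 + (-x) ^ 5 = 0 by ring]
    exact pow_eq_zero_iff (by norm_num) |>.1 this
  · rw [h]; exact (pow_dvd_pow_of_dvd h5 5).mul_left 9

theorem fifth_of_cube {n v : ℤ} (hn : n ≠ 0) (h : n ^ 3 = v ^ 5) : ∃ z, n = z ^ 5 := by
  have h6 : n ^ 5 * n = (v ^ 2) ^ 5 := by
    calc _ = (n ^ 3) ^ 2 := by ring
      _ = _ := by rw [h]; ring
  have hd : n ∣ v ^ 2 := (Int.pow_dvd_pow_iff (by norm_num : (5 : ℕ) ≠ 0)).1 ⟨n, h6.symm⟩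
  obtain ⟨z, hz⟩ := hd
  refine ⟨z, ?_⟩
  rw [hz, mul_pow] at h6
  exact mul_left_cancel₀ (pow_ne_zero 5 hn) h6

theorem coprime_of_fifth {x y : ℤ} (h : IsCoprime (x ^ 5) (y ^ 5)) : IsCoprime x y :=
  (IsCoprime.pow_iff (by norm_num) (by norm_num)).1 h

theorem no_mn {m n Z : ℤ} (hc : IsCoprime m n) (hm : m ≠ 0) (hn : n ≠ 0) (hmn : m - n ≠ 0)
    (h : 81 * (m * (m - n) * n ^ 3) = Z ^ 5) : False := by
  have p3 : Prime (3 : ℤ) := Int.prime_three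
  have h3Z : 3 ∣ Z := p3.dvd_of_dvd_pow (n := 5) (h ▸ Dvd.dvd.mul_right (by norm_num) _)
  obtain ⟨W, rfl⟩ := h3Z
  have h1 : m * (m - n) * n ^ 3 = 3 * W ^ 5 := by
    have : 81 * (m * (m - n) * n ^ 3) = 81 * (3 * W ^ 5) := by rw [h]; ring
    linarith
  have hcm : IsCoprime m (m - n) := by
    have := hc.neg_right.add_mul_left_right 1
    rw [mul_one, neg_add_eq_sub] at this
    exact this
  have hcn : IsCoprime (m - n) n := by
    have := hc.add_mul_left_left (-1)
    rwa [mul_neg_one, ← sub_eq_add_neg] at this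
  have h3 : 3 ∣ m * (m - n) * n ^ 3 := ⟨_, h1⟩
  rcases p3.dvd_or_dvd h3 with h3 | h3
  · rcases p3.dvd_or_dvd h3 with ⟨k, hk⟩ | ⟨k, hk⟩
    · have hkm : k ∣ m := ⟨3, by rw [hk]; ring⟩
      have h2 : k * ((m - n) * n ^ 3) = W ^ 5 := by
        have : 3 * (k * ((m - n) * n ^ 3)) = 3 * W ^ 5 := by rw [← h1]; nth_rewrite 2 [hk]; ring
        linarith
      obtain ⟨⟨x, hx⟩, ⟨v, hv⟩⟩ := Int.eq_pow_of_mul_eq_pow_odd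
        ((hcm.mul_right (hc.pow_right (n := 3))).of_isCoprime_of_dvd_left hkm) odd_five h2
      obtain ⟨⟨y, hy⟩, ⟨v, hv⟩⟩ := Int.eq_pow_of_mul_eq_pow_odd (hcn.pow_right (n := 3)) odd_five hv
      obtain ⟨z, hz⟩ := fifth_of_cube hn hv
      refine no_three (x := y) (y := z) (z := x) ?_ ?_ ?_
      · apply coprime_of_fifth; rwa [← hy, ← hz]
      · rintro rfl; apply hm; rw [hk, hx]; ring
      · rw [← hx, ← hy, ← hz]; linarith
    · have hkm : k ∣ m - n := ⟨3, by rw [hk]; ring⟩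
      have h2 : k * (m * n ^ 3) = W ^ 5 := by
        have : 3 * (k * (m * n ^ 3)) = 3 * W ^ 5 := by rw [← h1, hk]; ring
        linarith
      obtain ⟨⟨x, hx⟩, ⟨v, hv⟩⟩ := Int.eq_pow_of_mul_eq_pow_odd
        ((hcm.symm.mul_right (hcn.pow_right (n := 3))).of_isCoprime_of_dvd_left hkm) odd_five h2
      obtain ⟨⟨y, hy⟩, ⟨v, hv⟩⟩ := Int.eq_pow_of_mul_eq_pow_odd (hc.pow_right (n := 3)) odd_five hv
      obtain ⟨z, hz⟩ := fifth_of_cube hn hv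
      refine no_three (x := y) (y := -z) (z := x) ?_ ?_ ?_
      · apply IsCoprime.neg_right; apply coprime_of_fifth; rwa [← hy, ← hz]
      · rintro rfl; apply hmn; rw [hk, hx]; ring
      · rw [Odd.neg_pow odd_five, ← hx, ← hy, ← hz]; linarith
  · obtain ⟨k, hk⟩ := p3.dvd_of_dvd_pow h3
    have hk0 : k ≠ 0 := by rintro rfl; apply hn; rw [hk]; ring
    have hkn : k ∣ n := ⟨3, by rw [hk]; ring⟩
    have h2 : m * ((m - n) * (9 * k ^ 3)) = W ^ 5 := by
      have : 3 * (m * ((m - n) * (9 * k ^ 3))) = 3 * W ^ 5 := by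
        rw [← h1]
        have : n ^ 3 = 27 * k ^ 3 := by rw [hk]; ring
        rw [this]; ring
      linarith
    have hd9 : 9 * k ^ 3 ∣ n ^ 3 := ⟨3, by rw [hk]; ring⟩
    obtain ⟨⟨x, hx⟩, ⟨v, hv⟩⟩ := Int.eq_pow_of_mul_eq_pow_odd
        (hcm.mul_right ((hc.pow_right (n := 3)).of_isCoprime_of_dvd_right hd9)) odd_five h2
    obtain ⟨⟨y, hy⟩, ⟨v, hv⟩⟩ := Int.eq_pow_of_mul_eq_pow_odd
      ((hcn.pow_right (n := 3)).of_isCoprime_of_dvd_right hd9) odd_five hv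
    have h6 : k ^ 5 * (81 * k) = (v ^ 2) ^ 5 := by
      calc _ = (9 * k ^ 3) ^ 2 := by ring
        _ = _ := by rw [hv]; ring
    have hd : k ∣ v ^ 2 := (Int.pow_dvd_pow_iff (by norm_num : (5 : ℕ) ≠ 0)).1 ⟨_, h6.symm⟩
    obtain ⟨q, hq⟩ := hd
    rw [hq, mul_pow] at h6
    have h7 : 81 * k = q ^ 5 := mul_left_cancel₀ (pow_ne_zero 5 hk0) h6
    have h3q : 3 ∣ q := p3.dvd_of_dvd_pow (n := 5) (h7 ▸ Dvd.dvd.mul_right (by norm_num) _)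
    obtain ⟨z, rfl⟩ := h3q
    have h8 : n = 9 * z ^ 5 := by
      have : (3 * z) ^ 5 = 243 * z ^ 5 := by ring
      linarith
    refine no_nine (x := x) (y := -y) (z := z) ?_ ?_ ?_
    · apply IsCoprime.neg_right; apply coprime_of_fifth; rwa [← hx, ← hy]
    · rintro rfl; apply hn; rw [h8]; ring
    · rw [Odd.neg_pow odd_five, ← hx, ← hy, ← h8]; ring

theorem int_of_pow_five {q : ℚ} {k : ℤ} (h : q ^ 5 = k) : ∃ z : ℤ, k = z ^ 5 := by
  have hd : q.den ^ 5 = 1 := by rw [← Rat.den_pow, h]; simp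
  have hd1 : q.den = 1 := by
    exact (Nat.pow_eq_one.1 hd).resolve_right (by norm_num)
  refine ⟨q.num, ?_⟩
  have hq : (q.num : ℚ) = q := (Rat.den_eq_one_iff q).1 hd1
  rw [← hq] at h
  exact_mod_cast h.symm

/-- The only rational points on the genus-2 curve `Y^2 = X^5 + 20736`
are `(0, ±144)`. -/
theorem rational_points_Y2_eq_X5_add_20736 (X Y : ℚ)
    (h : Y ^ 2 = X ^ 5 + 20736) :
    (X = 0 ∧ Y = 144) ∨ (X = 0 ∧ Y = -144) := by
  by_cases hX : X = 0
  · subst hX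
    have : (Y - 144) * (Y + 144) = 0 := by linarith
    rcases mul_eq_zero.1 this with h | h
    · left; exact ⟨rfl, by linarith⟩
    · right; exact ⟨rfl, by linarith⟩
  exfalso
  have hX5 : X ^ 5 ≠ 0 := pow_ne_zero 5 hX
  obtain ⟨M, hM⟩ : ∃ M : ℚ, M = (Y + 144) / 288 := ⟨_, rfl⟩
  have hY : Y = 288 * M - 144 := by rw [hM]; ring
  have hE : X ^ 5 = 288 ^ 2 * (M * (M - 1)) := by
    have : X ^ 5 = Y ^ 2 - 20736 := by linarith
    rw [this, hY]; ring
  have hM0 : M ≠ 0 := by rintro h0; apply hX5; rw [hE, h0]; ring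
  have hM1 : M - 1 ≠ 0 := by rintro h0; apply hX5; rw [hE, h0]; ring
  have hden : (M.den : ℚ) ≠ 0 := by exact_mod_cast M.den_ne_zero
  have hMn : M * M.den = M.num := Rat.mul_den_eq_num M
  have hk : (X * M.den / 4) ^ 5 =
      ((81 * (M.num * (M.num - M.den) * (M.den : ℤ) ^ 3) : ℤ) : ℚ) := by
    push_cast
    rw [← hMn, div_pow, mul_pow, hE]; ring
  obtain ⟨Z, hZ⟩ := int_of_pow_five hk
  refine no_mn (m := M.num) (n := M.den) ?_ ?_ ?_ ?_ hZ
  · rw [Int.isCoprime_iff_gcd_eq_one]; exact M.reduced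
  · exact Rat.num_ne_zero.2 hM0
  · exact_mod_cast M.den_ne_zero
  · intro h0
    have h0' : (M.num : ℚ) - M.den = 0 := by exact_mod_cast h0
    rw [← hMn] at h0'
    have : (M - 1) * M.den = 0 := by linarith
    rcases mul_eq_zero.1 this with h | h
    · exact hM1 h
    · exact hden h
end

section
/- The only rational solutions (x, y) of the equation y^2 = x^3 + 25 are (x, y) = (0, 5) and (x, y) = (0, -5). Equivalently, the Mordell--Weil group of the elliptic curve E : y^2 = x^3 + 25 over \mathbb{Q} consists exactly of the identity O and the two points (0, 5) and (0, -5). -/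
/-- Eisenstein integers, with `ω ^ 2 = -1 - ω`. -/
abbrev Eis : Type := QuadraticAlgebra ℤ (-1) (-1)

namespace Eis

open QuadraticAlgebra

/-- Integer-valued norm. -/
abbrev nm (z : Eis) : ℤ := QuadraticAlgebra.norm z

theorem norm_eq (z : Eis) : nm z = z.re ^ 2 - z.re * z.im + z.im ^ 2 := by
  rw [nm, norm_def]; ring

theorem norm_nonneg (z : Eis) : 0 ≤ nm z := by
  rw [norm_eq]; nlinarith [sq_nonneg (z.re - z.im), sq_nonneg z.re, sq_nonneg z.im]

theorem norm_pos {z : Eis} (hz : z ≠ 0) : 0 < nm z := by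
  rcases (norm_nonneg z).lt_or_eq with h | h
  · exact h
  · exfalso
    apply hz
    rw [norm_eq] at h
    have h1 : z.re ^ 2 + z.im ^ 2 ≤ 0 := by nlinarith [sq_nonneg (z.re - z.im)]
    have h2 : z.re = 0 := by
      apply pow_eq_zero_iff (two_ne_zero) |>.1; nlinarith [sq_nonneg z.re, sq_nonneg z.im]
    have h3 : z.im = 0 := by
      apply pow_eq_zero_iff (two_ne_zero) |>.1; nlinarith [sq_nonneg z.re, sq_nonneg z.im]
    ext
    · simpa using h2
    · simpa using h3

/-- Rounded quotient. -/
def quo (x y : Eis) : Eis :=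
  ⟨round (((x * star y).re : ℚ) / (nm y : ℚ)), round (((x * star y).im : ℚ) / (nm y : ℚ))⟩

theorem norm_rem_lt (x : Eis) {y : Eis} (hy : y ≠ 0) : nm (x - y * quo x y) < nm y := by
  have hN := norm_pos hy
  have hNQ : (0 : ℚ) < (nm y : ℚ) := by exact_mod_cast hN
  have h1 := abs_sub_round (((x * star y).re : ℚ) / (nm y : ℚ))
  have h2 := abs_sub_round (((x * star y).im : ℚ) / (nm y : ℚ))
  set p := (x * star y).re with hp
  set q := (x * star y).im with hq
  have e1 : (quo x y).re = round ((p : ℚ) / (nm y : ℚ)) := rfl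
  have e2 : (quo x y).im = round ((q : ℚ) / (nm y : ℚ)) := rfl
  rw [← e1] at h1
  rw [← e2] at h2
  generalize quo x y = c at *
  have key : nm (x - y * c) * nm y =
      (p - nm y * c.re) ^ 2 - (p - nm y * c.re) * (q - nm y * c.im)
        + (q - nm y * c.im) ^ 2 := by
    simp only [hp, hq, norm_eq, re_sub, im_sub, re_mul, im_mul, re_star, im_star]
    ring
  have key2 : (nm (x - y * c) : ℚ) = nm y * (((p : ℚ) / nm y - c.re) ^ 2
      - ((p : ℚ) / nm y - c.re) * ((q : ℚ) / nm y - c.im) + ((q : ℚ) / nm y - c.im) ^ 2) := by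
    have : (nm (x - y * c) : ℚ) * nm y =
      (p - nm y * c.re) ^ 2 - (p - nm y * c.re) * (q - nm y * c.im)
        + (q - nm y * c.im) ^ 2 := by exact_mod_cast key
    field_simp
    linarith
  have : (nm (x - y * c) : ℚ) < nm y := by
    rw [key2]
    generalize (p : ℚ) / nm y - c.re = s at *
    generalize (q : ℚ) / nm y - c.im = t at *
    rw [abs_le] at h1 h2
    obtain ⟨h1, h3⟩ := h1
    obtain ⟨h2, h4⟩ := h2
    have : s ^ 2 - s * t + t ^ 2 < 1 := by nlinarith
    nlinarith
  exact_mod_cast this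

instance : EuclideanDomain Eis :=
  { (inferInstance : CommRing Eis), (inferInstance : Nontrivial Eis) with
    quotient := quo
    remainder := fun x y => x - y * quo x y
    quotient_zero := by intro x; ext <;> simp [quo]
    quotient_mul_add_remainder_eq := fun _ _ => by ring
    r := _
    r_wellFounded := (measure (fun z : Eis => Int.natAbs (nm z))).wf
    remainder_lt := fun x y hy => by
      have h1 := norm_rem_lt x hy
      have h2 := norm_nonneg (x - y * quo x y)
      show (nm (x - y * quo x y)).natAbs < (nm y).natAbs
      omega
    mul_left_not_lt := fun a b hb => by
      show ¬ (nm (a * b)).natAbs < (norm a).natAbs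
      have h1 := norm_pos hb
      rw [nm, map_mul, Int.natAbs_mul, not_lt]
      exact Nat.le_mul_of_pos_right _ (Int.natAbs_pos.2 h1.ne') }

theorem unit_cases (u : Eisˣ) : ∃ e : Eis, (u : Eis) = e ^ 3 ∨ (u : Eis) = ⟨0, 1⟩ * e ^ 3 ∨
    (u : Eis) = ⟨-1, -1⟩ * e ^ 3 := by
  have h : IsUnit (nm (u : Eis)) := isUnit_iff_norm_isUnit.1 u.isUnit
  have h1 : nm (u : Eis) = 1 := by
    rcases Int.isUnit_iff.1 h with h | h
    · exact h
    · have := norm_nonneg (u : Eis); omega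
  rw [norm_eq] at h1
  generalize (u : Eis) = v at *
  obtain ⟨a, b⟩ := v
  simp only at h1
  have ha : a ≤ 1 := by nlinarith [sq_nonneg (a - 2 * b)]
  have ha' : -1 ≤ a := by nlinarith [sq_nonneg (a - 2 * b)]
  have hb : b ≤ 1 := by nlinarith [sq_nonneg (b - 2 * a)]
  have hb' : -1 ≤ b := by nlinarith [sq_nonneg (b - 2 * a)]
  have hc : (1 : Eis) ^ 3 = 1 := one_pow 3
  have hm : (-1 : Eis) ^ 3 = -1 := by ring
  interval_cases a <;> interval_cases b <;> simp at h1
  · exact ⟨1, by rw [hc]; right; right; ext <;> simp⟩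
  · exact ⟨-1, by rw [hm]; left; ext <;> simp⟩
  · exact ⟨-1, by rw [hm]; right; left; ext <;> simp⟩
  · exact ⟨1, by rw [hc]; right; left; ext <;> simp⟩
  · exact ⟨1, by rw [hc]; left; ext <;> simp⟩
  · exact ⟨-1, by rw [hm]; right; right; ext <;> simp⟩

theorem cube_re (a b : ℤ) : ((⟨a, b⟩ : Eis) ^ 3).re = a ^ 3 + b ^ 3 - 3 * a * b ^ 2 := by
  rw [pow_succ, pow_two]; simp only [re_mul, im_mul]; ring

theorem cube_im (a b : ℤ) : ((⟨a, b⟩ : Eis) ^ 3).im = 3 * a * b * (a - b) := by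
  rw [pow_succ, pow_two]; simp only [re_mul, im_mul]; ring

end Eis

open QuadraticAlgebra in
theorem norm_form_cube {x y s : ℤ} (hxy : IsCoprime x y) (h : x ^ 2 - x * y + y ^ 2 = s ^ 3) :
    ∃ a b P Q : ℤ, P = a ^ 3 + b ^ 3 - 3 * a * b ^ 2 ∧ Q = 3 * a * b * (a - b) ∧
      ((x = P ∧ y = Q) ∨ (x = -Q ∧ y = P - Q) ∨ (x = Q - P ∧ y = -P)) := by
  have h3s : IsCoprime (3 : ℤ) (s ^ 3) := by
    apply IsCoprime.pow_right
    rw [Int.prime_three.coprime_iff_not_dvd]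
    rintro ⟨k, rfl⟩
    have h3 : (3 : ℤ) ∣ x + y := by
      apply Int.prime_three.dvd_of_dvd_pow (n := 2)
      exact ⟨9 * k ^ 3 + x * y, by linear_combination h⟩
    obtain ⟨m, hm⟩ := h3
    obtain rfl : x = 3 * m - y := by omega
    have h4 : (3 : ℤ) ∣ y := by
      apply Int.prime_three.dvd_of_dvd_pow (n := 2)
      exact ⟨3 * k ^ 3 - m ^ 2 + m * y, by linarith⟩
    have h5 := hxy.isUnit_of_dvd' (by omega : (3 : ℤ) ∣ 3 * m - y) h4
    rw [Int.isUnit_iff] at h5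
    omega
  set α : Eis := ⟨x, y⟩ with hα
  set β : Eis := ⟨x - y, -y⟩ with hβ
  have hmul : α * β = (⟨s, 0⟩ : Eis) ^ 3 := by
    ext
    · rw [Eis.cube_re]; simp only [hα, hβ, re_mul]; linear_combination h
    · rw [Eis.cube_im]; simp only [hα, hβ, im_mul]; ring
  have hcop : IsCoprime α β := by
    obtain ⟨u, v, huv⟩ := hxy
    obtain ⟨p, q, hpq⟩ := h3s
    refine ⟨⟨3 * 0, 0⟩ + ⟨p * u, 0⟩ * (⟨1, 2⟩ * ⟨-1, -1⟩) - ⟨p * v, 0⟩ * ⟨1, 2⟩ + ⟨q, 0⟩ * β,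
      - ⟨p * u, 0⟩ * (⟨1, 2⟩ * ⟨0, 1⟩) + ⟨p * v, 0⟩ * ⟨1, 2⟩, ?_⟩
    ext
    · simp only [hα, hβ, re_mul, im_mul, re_add, im_add, re_sub, im_sub, re_neg, im_neg, re_one]
      linear_combination hpq + 3 * p * huv + q * h
    · simp only [hα, hβ, re_mul, im_mul, re_add, im_add, re_sub, im_sub, re_neg, im_neg, im_one]
      ring
  obtain ⟨d, u, hd⟩ := exists_associated_pow_of_mul_eq_pow' hcop hmul
  obtain ⟨e, he⟩ := Eis.unit_cases u
  have hg : ∃ γ : Eis, α = γ ^ 3 ∨ α = ⟨0, 1⟩ * γ ^ 3 ∨ α = ⟨-1, -1⟩ * γ ^ 3 := by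
    refine ⟨d * e, ?_⟩
    rw [← hd]
    rcases he with he | he | he
    · left; rw [he]; ring
    · right; left; rw [he]; ring
    · right; right; rw [he]; ring
  obtain ⟨⟨a, b⟩, hg⟩ := hg
  refine ⟨a, b, _, _, rfl, rfl, ?_⟩
  rw [← Eis.cube_re, ← Eis.cube_im]
  generalize (⟨a, b⟩ : Eis) ^ 3 = g at *
  rcases hg with hg | hg | hg
  · left; rw [← hg]; exact ⟨rfl, rfl⟩
  · right; left
    have h1 := congrArg re hg
    have h2 := congrArg im hg
    simp only [re_mul, im_mul, hα] at h1 h2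
    exact ⟨by linarith, by linarith⟩
  · right; right
    have h1 := congrArg re hg
    have h2 := congrArg im hg
    simp only [re_mul, im_mul, hα] at h1 h2
    exact ⟨by linarith, by linarith⟩

theorem cube_mod_nine (t : ℤ) :
    (t ^ 3 % 9 = 0 ∧ t % 3 = 0) ∨ (t ^ 3 % 9 = 1 ∧ t % 3 = 1) ∨ (t ^ 3 % 9 = 8 ∧ t % 3 = 2) := by
  have h : t % 9 = 0 ∨ t % 9 = 1 ∨ t % 9 = 2 ∨ t % 9 = 3 ∨ t % 9 = 4 ∨ t % 9 = 5 ∨ t % 9 = 6 ∨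
    t % 9 = 7 ∨ t % 9 = 8 := by omega
  have h3 : t % 3 = (t % 9) % 3 := by omega
  rcases h with h | h | h | h | h | h | h | h | h <;> rw [h3, pow_succ, pow_two] <;>
    simp [Int.mul_emod, h]

theorem not_coprime_of_dvd {p x y : ℤ} (hp : Prime p) (hxy : IsCoprime x y) (hx : p ∣ x)
    (hy : p ∣ y) : False :=
  hp.not_isUnit (hxy.isUnit_of_dvd' hx hy)

theorem prime_five_int : Prime (5 : ℤ) := by
  rw [Int.prime_iff_natAbs_prime]; norm_num

theorem three_cubes {A B C r : ℤ} (hAB : IsCoprime A B) (hAC : IsCoprime A C) (hBC : IsCoprime B C)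
    (h : A * B * C = r ^ 3) : ∃ u v w, A = u ^ 3 ∧ B = v ^ 3 ∧ C = w ^ 3 := by
  have h3 : Odd 3 := by decide
  obtain ⟨⟨m, hm⟩, ⟨w, hw⟩⟩ := Int.eq_pow_of_mul_eq_pow_odd (hAC.mul_left hBC) h3 h
  obtain ⟨⟨u, hu⟩, ⟨v, hv⟩⟩ := Int.eq_pow_of_mul_eq_pow_odd hAB h3 hm
  exact ⟨u, v, w, hu, hv, hw⟩

theorem cube_inj {a b : ℤ} (h : a ^ 3 = b ^ 3) : a = b :=
  (Odd.strictMono_pow (R := ℤ) (by decide : Odd 3)).injective h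

theorem case_ten {A B C r : ℤ} (hAB : IsCoprime A B) (hAC : IsCoprime A C) (hBC : IsCoprime B C)
    (hs : A + B + C = 0) (h : A * B * C = 10 * r ^ 3) (h2 : (2 : ℤ) ∣ A) (h5 : (5 : ℤ) ∣ A) :
    ∃ u v w : ℤ, IsCoprime u v ∧ u ^ 3 + v ^ 3 = 10 * w ^ 3 ∧ w ∣ r := by
  obtain ⟨A, rfl⟩ : (10 : ℤ) ∣ A := by omega
  obtain ⟨w, u, v, rfl, rfl, rfl⟩ := three_cubes (r := r) hAB.of_mul_left_right
    hAC.of_mul_left_right hBC (by linarith)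
  refine ⟨u, v, -w, ?_, by linarith, ?_⟩
  · exact (IsCoprime.pow_iff (by norm_num) (by norm_num)).1 hBC
  · have : r = w * u * v := cube_inj (by linarith)
    rw [this]
    exact ⟨-(u * v), by ring⟩

theorem case_two_five {A B C r : ℤ} (hAB : IsCoprime A B) (hAC : IsCoprime A C)
    (hBC : IsCoprime B C)
    (hs : A + B + C = 0) (h : A * B * C = 10 * r ^ 3) (h2 : (2 : ℤ) ∣ A) (h5 : (5 : ℤ) ∣ B) :
    False := by
  obtain ⟨A, rfl⟩ := h2
  obtain ⟨B, rfl⟩ := h5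
  obtain ⟨u, v, w, rfl, rfl, rfl⟩ := three_cubes (r := r) hAB.of_mul_left_right.of_mul_right_right
    hAC.of_mul_left_right hBC.of_mul_left_right (by linarith)
  have hu := cube_mod_nine u
  have hv := cube_mod_nine v
  have hw := cube_mod_nine w
  exact not_coprime_of_dvd Int.prime_three hAB (by omega) (by omega)

theorem split_coprime {A B C r : ℤ} (hAB : IsCoprime A B) (hs : A + B + C = 0)
    (h : A * B * C = 10 * r ^ 3) :
    ∃ u v w : ℤ, IsCoprime u v ∧ u ^ 3 + v ^ 3 = 10 * w ^ 3 ∧ w ∣ r := by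
  have hC : C = -(A + B) := by omega
  have hAC : IsCoprime A C := by
    obtain ⟨p, q, hpq⟩ := hAB
    exact ⟨p - q, -q, by rw [hC]; linear_combination hpq⟩
  have hBC : IsCoprime B C := by
    obtain ⟨p, q, hpq⟩ := hAB
    exact ⟨q - p, -p, by rw [hC]; linear_combination hpq⟩
  have d2 : (2 : ℤ) ∣ A ∨ (2 : ℤ) ∣ B ∨ (2 : ℤ) ∣ C := by
    have : (2 : ℤ) ∣ A * B * C := ⟨5 * r ^ 3, by linarith⟩
    rcases Int.prime_two.dvd_or_dvd this with h | h
    · rcases Int.prime_two.dvd_or_dvd h with h | h <;> simp [h]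
    · simp [h]
  have d5 : (5 : ℤ) ∣ A ∨ (5 : ℤ) ∣ B ∨ (5 : ℤ) ∣ C := by
    have : (5 : ℤ) ∣ A * B * C := ⟨2 * r ^ 3, by linarith⟩
    rcases prime_five_int.dvd_or_dvd this with h | h
    · rcases prime_five_int.dvd_or_dvd h with h | h <;> simp [h]
    · simp [h]
  rcases d2 with d2 | d2 | d2 <;> rcases d5 with d5 | d5 | d5
  · exact case_ten hAB hAC hBC hs h d2 d5
  · exact (case_two_five hAB hAC hBC hs h d2 d5).elim
  · exact (case_two_five hAC hAB hBC.symm (by linarith) (by linarith) d2 d5).elim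
  · exact (case_two_five hAB.symm hBC hAC (r := r) (by linarith) (by linarith) d2 d5).elim
  · exact case_ten hAB.symm hBC hAC (by linarith) (by linarith) d2 d5
  · exact (case_two_five hBC hAB.symm hAC.symm (r := r) (by linarith) (by linarith) d2 d5).elim
  · exact (case_two_five hAC.symm hBC.symm hAB (r := r) (by linarith) (by linarith) d2 d5).elim
  · exact (case_two_five hBC.symm hAC.symm hAB.symm (r := r) (by linarith) (by linarith)
      d2 d5).elim
  · exact case_ten hAC.symm hBC.symm hAB (by linarith) (by linarith) d2 d5

theorem norm_form_coprime_ten {x y : ℤ} (hxy : IsCoprime x y) :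
    IsCoprime (10 : ℤ) (x ^ 2 - x * y + y ^ 2) := by
  rw [show (10 : ℤ) = 2 * 5 by norm_num]
  apply IsCoprime.mul_left
  · rw [Int.prime_two.coprime_iff_not_dvd]
    intro hd
    have hx : x % 2 = 0 ∨ x % 2 = 1 := by omega
    have hy : y % 2 = 0 ∨ y % 2 = 1 := by omega
    have h0 := Int.emod_eq_zero_of_dvd hd
    have key : x % 2 = 0 ∧ y % 2 = 0 := by
      rcases hx with hx | hx <;> rcases hy with hy | hy <;>
      simp [pow_two, Int.add_emod, Int.sub_emod, Int.mul_emod, hx, hy] at h0 ⊢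
    exact not_coprime_of_dvd Int.prime_two hxy (by omega) (by omega)
  · rw [prime_five_int.coprime_iff_not_dvd]
    intro hd
    have hx : x % 5 = 0 ∨ x % 5 = 1 ∨ x % 5 = 2 ∨ x % 5 = 3 ∨ x % 5 = 4 := by omega
    have hy : y % 5 = 0 ∨ y % 5 = 1 ∨ y % 5 = 2 ∨ y % 5 = 3 ∨ y % 5 = 4 := by omega
    have h0 := Int.emod_eq_zero_of_dvd hd
    have key : x % 5 = 0 ∧ y % 5 = 0 := by
      rcases hx with hx | hx | hx | hx | hx <;> rcases hy with hy | hy | hy | hy | hy <;>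
      simp [pow_two, Int.add_emod, Int.sub_emod, Int.mul_emod, hx, hy] at h0 ⊢
    exact not_coprime_of_dvd prime_five_int hxy (by omega) (by omega)

theorem sum_coprime_mul {x y : ℤ} (hxy : IsCoprime x y) : IsCoprime (x + y) (x * y) := by
  obtain ⟨p, q, hpq⟩ := hxy
  apply IsCoprime.mul_right
  · exact ⟨q, p - q, by linear_combination hpq⟩
  · exact ⟨p, q - p, by linear_combination hpq⟩

theorem two_dvd_Q (a b : ℤ) : (2 : ℤ) ∣ 3 * a * b * (a - b) := by
  have ha : a % 2 = 0 ∨ a % 2 = 1 := by omega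
  have hb : b % 2 = 0 ∨ b % 2 = 1 := by omega
  apply Int.dvd_of_emod_eq_zero
  rcases ha with hx | hx <;> rcases hb with hy | hy <;>
    simp [Int.sub_emod, Int.mul_emod, hx, hy]

/-- The case where `3` does not divide `z`. -/
theorem case_not_three {x y r s : ℤ} (hxy : IsCoprime x y) (h1 : x + y = 10 * r ^ 3)
    (h2 : x ^ 2 - x * y + y ^ 2 = s ^ 3) (h3 : (3 : ℤ) ∣ x ∨ (3 : ℤ) ∣ y) : False := by
  obtain ⟨a, b, P, Q, hP, hQ, h⟩ := norm_form_cube hxy h2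
  have hQ2 : (2 : ℤ) ∣ Q := hQ ▸ two_dvd_Q a b
  have hQ3 : (3 : ℤ) ∣ Q := ⟨a * b * (a - b), by rw [hQ]; ring⟩
  have hs : (2 : ℤ) ∣ x + y := ⟨5 * r ^ 3, by rw [h1]; ring⟩
  rcases h with ⟨hx, hy⟩ | ⟨hx, hy⟩ | ⟨hx, hy⟩
  · exact not_coprime_of_dvd Int.prime_two hxy (by omega) (by omega)
  · exact not_coprime_of_dvd Int.prime_two hxy (by omega) (by omega)
  · exact not_coprime_of_dvd Int.prime_three hxy (by omega) (by omega)

/-- The case where `3` divides `z`. -/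
theorem case_three {x y r s : ℤ} (hxy : IsCoprime x y) (h1 : x + y = 90 * r ^ 3)
    (h2 : x ^ 2 - x * y + y ^ 2 = 3 * s ^ 3) :
    ∃ u v w : ℤ, IsCoprime u v ∧ u ^ 3 + v ^ 3 = 10 * w ^ 3 ∧ w ∣ r := by
  set Q0 := 30 * r ^ 3 with hQ0
  set P0 := x - Q0 with hP0
  have hx0 : x = P0 + Q0 := by omega
  have hy0 : y = 2 * Q0 - P0 := by omega
  have hc : IsCoprime P0 Q0 := by
    obtain ⟨p, q, hpq⟩ := hxy
    exact ⟨p - q, p + 2 * q, by rw [← hpq, hx0, hy0]; ring⟩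
  have hn : P0 ^ 2 - P0 * Q0 + Q0 ^ 2 = s ^ 3 := by
    rw [hx0, hy0] at h2; linarith
  obtain ⟨a, b, P, Q, hP, hQ, h⟩ := norm_form_cube hc hn
  have hQ3 : (3 : ℤ) ∣ Q := ⟨a * b * (a - b), by rw [hQ]; ring⟩
  rcases h with ⟨hx, hy⟩ | ⟨hx, hy⟩ | ⟨hx, hy⟩
  · have hab : IsCoprime a (-b) := by
      rw [hx, hy, hP, hQ] at hc
      obtain ⟨p, q, hpq⟩ := hc
      exact ⟨p * a ^ 2 + q * (3 * b * (a - b)), -(p * (b ^ 2 - 3 * a * b)),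
        by rw [← hpq]; ring⟩
    obtain ⟨u, v, w, h4, h5, h6⟩ := split_coprime (C := b - a) (r := r) hab (by ring) (by linarith)
    exact ⟨u, v, w, h4, h5, h6⟩
  · exact (not_coprime_of_dvd Int.prime_three hc (by omega) (by omega)).elim
  · exact (not_coprime_of_dvd Int.prime_three hc (by omega) (by omega)).elim

theorem sum_cubes_ten (n : ℕ) : ∀ x y z : ℤ, z.natAbs = n → IsCoprime x y →
    x ^ 3 + y ^ 3 = 10 * z ^ 3 → z = 0 := by
  induction n using Nat.strong_induction_on with
  | _ n ih =>
  intro x y z hz hxy h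
  by_contra hz0
  have hpq : (x + y) * (x ^ 2 - x * y + y ^ 2) = 10 * z ^ 3 := by linarith
  have hx9 := cube_mod_nine x
  have hy9 := cube_mod_nine y
  have hz9 := cube_mod_nine z
  have h10 := norm_form_coprime_ten hxy
  have hsc := sum_coprime_mul hxy
  have hodd : Odd 3 := by decide
  by_cases h3 : (3 : ℤ) ∣ z
  · obtain ⟨w, rfl⟩ := h3
    have h3p : (3 : ℤ) ∣ x + y := by omega
    obtain ⟨p1, hp1⟩ := h3p
    have hq : x ^ 2 - x * y + y ^ 2 = 3 * (3 * p1 ^ 2 - x * y) := by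
      have : (x + y) ^ 2 = (3 * p1) ^ 2 := by rw [hp1]
      linarith
    rw [hq, hp1] at hpq
    rw [hp1] at hsc
    rw [hq] at h10
    have e1 : p1 * (3 * p1 ^ 2 - x * y) = 30 * w ^ 3 := by linarith
    have c3 : IsCoprime (3 : ℤ) (3 * p1 ^ 2 - x * y) := by
      obtain ⟨p, q, hpq⟩ := hsc
      exact ⟨p * p1 + q * p1 ^ 2, -q, by linear_combination hpq⟩
    have c30 : IsCoprime (30 : ℤ) (3 * p1 ^ 2 - x * y) := by
      rw [show (30 : ℤ) = 3 * 10 by norm_num]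
      exact c3.mul_left h10.of_mul_right_right
    obtain ⟨p2, rfl⟩ : (30 : ℤ) ∣ p1 := c30.dvd_of_dvd_mul_right ⟨w ^ 3, e1⟩
    have c : IsCoprime p2 (3 * (30 * p2) ^ 2 - x * y) := by
      obtain ⟨p, q, hpq⟩ := hsc
      exact ⟨p * 90 + q * 2700 * p2, -q, by linear_combination hpq⟩
    obtain ⟨⟨r, hr⟩, ⟨s, hs⟩⟩ := Int.eq_pow_of_mul_eq_pow_odd (c := w) c hodd (by linarith)
    rw [hs] at hq
    obtain ⟨u, v, t, huv, ht, htr⟩ := case_three (r := r) hxy (by rw [hp1, hr]; ring) hq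
    have hw : w = r * s := by
      apply cube_inj
      rw [hs, hr] at e1
      linarith
    have hr0 : r ≠ 0 := by rintro rfl; simp at hw; omega
    have ht0 : t ≠ 0 := by rintro rfl; exact hr0 (zero_dvd_iff.1 htr)
    have hle : t.natAbs ≤ w.natAbs := by
      apply Nat.le_of_dvd (by omega)
      rw [Int.natAbs_dvd_natAbs, hw]
      exact htr.mul_right s
    exact ht0 (ih t.natAbs (by omega) u v t rfl huv ht)
  · have h3p : ¬ (3 : ℤ) ∣ x + y := by omega
    have c3 : IsCoprime (x + y) (3 : ℤ) := (Int.prime_three.coprime_iff_not_dvd.2 h3p).symm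
    obtain ⟨p1, hp1⟩ : (10 : ℤ) ∣ x + y := h10.dvd_of_dvd_mul_right ⟨z ^ 3, hpq⟩
    have c : IsCoprime (x + y) (x ^ 2 - x * y + y ^ 2) := by
      obtain ⟨p, q, hpq⟩ := c3.mul_right hsc
      exact ⟨p + q * (x + y), -q, by linear_combination hpq⟩
    rw [hp1] at c hpq
    obtain ⟨⟨r, hr⟩, ⟨s, hs⟩⟩ := Int.eq_pow_of_mul_eq_pow_odd (c := z) c.of_mul_left_right hodd
      (by linarith)
    exact case_not_three hxy (by rw [hp1, hr]) hs (by omega)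

theorem mul_add_ten {A B r : ℤ} (h : A * B * -(A + B) = 10 * r ^ 3) : r = 0 := by
  by_contra hr
  have hA : A ≠ 0 := by
    rintro rfl
    have : r ^ 3 = 0 := by linarith
    exact hr (by simpa using this)
  obtain ⟨A', B', hAB, hA', hB'⟩ : ∃ A' B' : ℤ, IsCoprime A' B' ∧ A = A' * (Int.gcd A B : ℤ) ∧
      B = B' * (Int.gcd A B : ℤ) := by
    obtain ⟨A', B', h1, h2, h3⟩ := Int.exists_gcd_one (Int.gcd_pos_of_ne_zero_left B hA)
    exact ⟨A', B', Int.isCoprime_iff_gcd_eq_one.2 h1, h2, h3⟩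
  have hg : (Int.gcd A B : ℤ) ≠ 0 := by
    have := Int.gcd_pos_of_ne_zero_left B hA
    omega
  generalize (Int.gcd A B : ℤ) = g at *
  subst hA' hB'
  obtain ⟨k, rfl⟩ : g ∣ r := by
    obtain ⟨g', r', h1, h2, h3⟩ := Int.exists_gcd_one (Int.gcd_pos_of_ne_zero_left r hg)
    have hc := Int.isCoprime_iff_gcd_eq_one.2 h1
    have hd : (Int.gcd g r : ℤ) ≠ 0 := by
      have := Int.gcd_pos_of_ne_zero_left r hg
      omega
    generalize (Int.gcd g r : ℤ) = d at *
    subst h2 h3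
    have e : g' ^ 3 * (A' * B' * -(A' + B')) = 10 * r' ^ 3 := by
      apply mul_right_cancel₀ (pow_ne_zero 3 hd)
      linarith
    have hdv : g' ^ 3 ∣ 10 := (hc.pow (m := 3) (n := 3)).dvd_of_dvd_mul_right ⟨_, e.symm⟩
    have hle := Int.le_of_dvd (by norm_num) hdv
    have hdv' : (-g') ^ 3 ∣ 10 := by rw [Odd.neg_pow (by decide)]; exact (neg_dvd).2 hdv
    have hle' := Int.le_of_dvd (by norm_num) hdv'
    have b1 : g' ≤ 2 := by
      by_contra hh
      have : (3 : ℤ) ^ 3 ≤ g' ^ 3 := pow_le_pow_left₀ (by norm_num) (by omega) 3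
      omega
    have b2 : -g' ≤ 2 := by
      by_contra hh
      have : (3 : ℤ) ^ 3 ≤ (-g') ^ 3 := pow_le_pow_left₀ (by norm_num) (by omega) 3
      omega
    have b3 : -2 ≤ g' := by omega
    have : g' ∣ 1 := by
      clear e hle hle' b2 h1 hc hdv' h hg
      interval_cases g' <;> revert hdv <;> decide
    exact mul_dvd_mul (this.trans (one_dvd _)) (dvd_refl d)
  have e : A' * B' * -(A' + B') = 10 * k ^ 3 := by
    apply mul_right_cancel₀ (pow_ne_zero 3 hg)
    linarith
  obtain ⟨u, v, w, huv, h1, hw⟩ := split_coprime hAB (by ring) e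
  have := sum_cubes_ten _ u v w rfl huv h1
  subst this
  rw [zero_dvd_iff] at hw
  simp [hw] at hr

/-- The only rational points on the elliptic curve `y^2 = x^3 + 25`
(besides the point at infinity) are `(0, ±5)`. -/
theorem rational_points_y2_eq_x3_add_25 (x y : ℚ)
    (h : y ^ 2 = x ^ 3 + 25) :
    (x = 0 ∧ y = 5) ∨ (x = 0 ∧ y = -5) := by
  have hx : x = 0 := by
    have hxd : (x.den : ℚ) ≠ 0 := by exact_mod_cast x.den_nz
    have hyd : (y.den : ℚ) ≠ 0 := by exact_mod_cast y.den_nz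
    have ex : x * x.den = x.num := Rat.mul_den_eq_num x
    have ey : y * y.den = y.num := Rat.mul_den_eq_num y
    obtain ⟨D, hD⟩ : ∃ D : ℤ, D = x.den * y.den := ⟨_, rfl⟩
    obtain ⟨X, hX⟩ : ∃ X : ℤ, X = x.num * x.den * y.den ^ 2 := ⟨_, rfl⟩
    obtain ⟨Y, hY⟩ : ∃ Y : ℤ, Y = y.num * x.den ^ 3 * y.den ^ 2 := ⟨_, rfl⟩
    have hD0 : (D : ℚ) ≠ 0 := by rw [hD]; push_cast; exact mul_ne_zero hxd hyd
    have hXq : (X : ℚ) = x * D ^ 2 := by rw [hX, hD]; push_cast; rw [← ex]; ring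
    have hYq : (Y : ℚ) = y * D ^ 3 := by rw [hY, hD]; push_cast; rw [← ey]; ring
    have key : Y ^ 2 = X ^ 3 + 25 * D ^ 6 := by
      have : (Y : ℚ) ^ 2 = X ^ 3 + 25 * D ^ 6 := by
        rw [hXq, hYq]; linear_combination (D : ℚ) ^ 6 * h
      exact_mod_cast this
    have h0 := mul_add_ten (A := Y + 5 * D ^ 3) (B := -(Y - 5 * D ^ 3)) (r := X * D)
      (by linear_combination 10 * D ^ 3 * key)
    have h1 : (X : ℚ) * D = 0 := by exact_mod_cast h0
    rw [hXq] at h1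
    simpa [hD0] using h1
  subst hx
  have h2 : (y - 5) * (y + 5) = 0 := by linarith
  rcases mul_eq_zero.1 h2 with h2 | h2
  · left; exact ⟨rfl, by linarith⟩
  · right; exact ⟨rfl, by linarith⟩
end

section
/- If u, v, y are rational numbers with (u, v) \neq (0, 0) satisfying 5y^2 = 45u^4 - v^4, then v = 0. In particular, the only rational points on the genus 1 curve D' : 45u^4 - v^4 = 5y^2 (in weighted projective space, with u, v of weight 1 and y of weight 2) are (u : v : y) = (1 : 0 : 3) and (1 : 0 : -3). -/
theorem aux_fac (a b k n : ℕ) (hk : 0 < k) (hc : Nat.Coprime a b)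
    (h : a * b = k * n ^ 4) :
    ∃ k₁ k₂ r s, k₁ * k₂ = k ∧ Nat.Coprime k₁ k₂ ∧ a = k₁ * r ^ 4 ∧ b = k₂ * s ^ 4 ∧
      r * s = n ∧ Nat.Coprime r s := by
  have hkk : Nat.gcd k a * Nat.gcd k b = k := by
    rw [← Nat.Coprime.gcd_mul k hc]
    exact Nat.gcd_eq_left ⟨_, h⟩
  obtain ⟨a', ha'⟩ := Nat.gcd_dvd_right k a
  obtain ⟨b', hb'⟩ := Nat.gcd_dvd_right k b
  have hck : Nat.Coprime (Nat.gcd k a) (Nat.gcd k b) :=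
    Nat.Coprime.coprime_dvd_left (Nat.gcd_dvd_right k a)
      (Nat.Coprime.coprime_dvd_right (Nat.gcd_dvd_right k b) hc)
  have hcab : Nat.Coprime a' b' :=
    Nat.Coprime.coprime_dvd_left (Dvd.intro_left _ ha'.symm)
      (Nat.Coprime.coprime_dvd_right (Dvd.intro_left _ hb'.symm) hc)
  generalize Nat.gcd k a = k₁ at *
  generalize Nat.gcd k b = k₂ at *
  have hab : a' * b' = n ^ 4 := by
    apply Nat.eq_of_mul_eq_mul_left hk
    rw [← h, ha', hb', ← hkk]; ring
  obtain ⟨r, hr⟩ := exists_eq_pow_of_mul_eq_pow (Nat.isUnit_iff.2 hcab) hab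
  obtain ⟨s, hs⟩ := exists_eq_pow_of_mul_eq_pow (Nat.isUnit_iff.2 hcab.symm)
    ((mul_comm b' a').trans hab)
  refine ⟨k₁, k₂, r, s, hkk, hck, by rw [ha', hr], by rw [hb', hs], ?_, ?_⟩
  · apply Nat.pow_left_injective (n := 4) (by norm_num)
    simp only [mul_pow, ← hr, ← hs, hab]
  · rw [hr, hs] at hcab
    exact (Nat.coprime_pow_left_iff (by norm_num) _ _).1
      ((Nat.coprime_pow_right_iff (by norm_num) _ _).1 hcab)

theorem aux_cop (a b : ℕ) (h : Nat.Coprime (a + b) (a * b)) : Nat.Coprime a b := by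
  have := Nat.Coprime.coprime_dvd_right (Dvd.intro _ rfl : a ∣ a * b) h
  simpa [Nat.coprime_comm] using this

theorem aux_cop2 (b d : ℕ) (h : Nat.Coprime d (b * (b + d))) : Nat.Coprime b (b + d) := by
  have := Nat.Coprime.coprime_dvd_right (Dvd.intro _ rfl : b ∣ b * (b + d)) h
  simpa [Nat.coprime_comm] using this

theorem aux_m3 (n : ℕ) : (n % 3 = 0 ∧ n ^ 2 % 3 = 0 ∧ n ^ 4 % 3 = 0) ∨
    (n % 3 ≠ 0 ∧ n ^ 2 % 3 = 1 ∧ n ^ 4 % 3 = 1) := by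
  have : n % 3 < 3 := Nat.mod_lt _ (by norm_num)
  interval_cases h : n % 3 <;> simp [Nat.pow_mod, h]

theorem aux_m5 (n : ℕ) : (n % 5 = 0 ∧ n ^ 2 % 5 = 0 ∧ n ^ 4 % 5 = 0) ∨
    (n % 5 ≠ 0 ∧ (n ^ 2 % 5 = 1 ∨ n ^ 2 % 5 = 4) ∧ n ^ 4 % 5 = 1) := by
  have : n % 5 < 5 := Nat.mod_lt _ (by norm_num)
  interval_cases h : n % 5 <;> simp [Nat.pow_mod, h]

theorem aux_m16 (n : ℕ) : (n % 2 = 0 ∧ (n ^ 2 % 16 = 0 ∨ n ^ 2 % 16 = 4) ∧ n ^ 4 % 16 = 0) ∨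
    (n % 2 = 1 ∧ (n ^ 2 % 16 = 1 ∨ n ^ 2 % 16 = 9) ∧ n ^ 4 % 16 = 1) := by
  have : n % 16 < 16 := Nat.mod_lt _ (by norm_num)
  have h2 : n % 2 = n % 16 % 2 := by omega
  rw [h2]
  interval_cases h : n % 16 <;> simp [Nat.pow_mod, h]

theorem aux_c2 (n : ℕ) : Nat.Coprime n 2 ↔ n % 2 ≠ 0 := by
  rw [Nat.coprime_comm, Nat.Prime.coprime_iff_not_dvd Nat.prime_two, Nat.dvd_iff_mod_eq_zero]
theorem aux_c3 (n : ℕ) : Nat.Coprime n 3 ↔ n % 3 ≠ 0 := by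
  rw [Nat.coprime_comm, Nat.Prime.coprime_iff_not_dvd Nat.prime_three, Nat.dvd_iff_mod_eq_zero]
theorem aux_c5 (n : ℕ) : Nat.Coprime n 5 ↔ n % 5 ≠ 0 := by
  rw [Nat.coprime_comm, Nat.Prime.coprime_iff_not_dvd Nat.prime_five, Nat.dvd_iff_mod_eq_zero]

theorem aux_not2 (p u w : ℕ) (hp : 1 < p) (h : Nat.Coprime u w) (hu : u % p = 0) :
    w % p ≠ 0 := fun hw =>
  Nat.not_coprime_of_dvd_of_dvd hp (Nat.dvd_of_mod_eq_zero hu) (Nat.dvd_of_mod_eq_zero hw) h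

set_option maxHeartbeats 1000000 in
theorem aux_basic (u w y : ℕ) (hc : Nat.Coprime u w) (h : y ^ 2 + 125 * w ^ 4 = 9 * u ^ 4) :
    u % 2 = 1 ∧ w % 2 = 0 ∧ y % 2 = 1 ∧ u % 5 ≠ 0 := by
  have e2 := aux_not2 2 u w (by norm_num) hc
  have hu := aux_m16 u
  have hw := aux_m16 w
  have hy := aux_m16 y
  refine ⟨by clear * - e2 hu hw hy h; omega, by clear * - e2 hu hw hy h; omega, by clear * - e2 hu hw hy h; omega, fun h5 => ?_⟩
  have e5 := aux_not2 5 u w (by norm_num) hc h5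
  have hw5 := aux_m5 w
  have hy5 := aux_m5 y
  obtain ⟨m, rfl⟩ := Nat.dvd_of_mod_eq_zero h5
  have : y % 5 = 0 := by
    ring_nf at h hy5; clear * - h hy5; omega
  obtain ⟨n, rfl⟩ := Nat.dvd_of_mod_eq_zero this
  have h' : n ^ 2 + 5 * w ^ 4 = 225 * m ^ 4 := by linarith
  have hn5 := aux_m5 n
  have : n % 5 = 0 := by clear * - h' hn5; omega
  obtain ⟨l, rfl⟩ := Nat.dvd_of_mod_eq_zero this
  have h'' : 5 * l ^ 2 + w ^ 4 = 45 * m ^ 4 := by linarith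
  clear * - h'' hw5 e5
  omega

set_option maxHeartbeats 1000000 in
theorem aux_caseA (u w y : ℕ) (hw0 : 0 < w) (hc : Nat.Coprime u w)
    (h : y ^ 2 + 125 * w ^ 4 = 9 * u ^ 4) : w % 3 = 0 := by
  by_contra h3
  obtain ⟨hu, hw, hy, hu5⟩ := aux_basic u w y hc h
  obtain ⟨x, rfl⟩ := Nat.dvd_of_mod_eq_zero hw
  have hx : 0 < x := by omega
  have hlt : y ≤ 3 * u ^ 2 := by
    by_contra hlt
    push Not at hlt
    linarith [Nat.zero_le (x ^ 4), Nat.pow_lt_pow_left hlt two_ne_zero]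
  obtain ⟨A, hA⟩ : ∃ A, 3 * u ^ 2 = y + 2 * A := by
    refine ⟨(3 * u ^ 2 - y) / 2, ?_⟩
    have := aux_m16 u
    omega
  have hprod : A * (A + y) = 500 * x ^ 4 := by
    have : (3 * u ^ 2) ^ 2 = (y + 2 * A) ^ 2 := by rw [hA]
    linarith
  have hcop : Nat.Coprime A (A + y) := by
    apply aux_cop
    rw [hprod, show A + (A + y) = 3 * u ^ 2 by omega]
    have c1 : Nat.Coprime u x := Nat.Coprime.coprime_mul_left_right hc
    have c5 := (aux_c5 u).2 hu5
    have c2 := (aux_c2 u).2 (by omega)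
    have c3 : Nat.Coprime 3 x := ((aux_c3 x).2 (by omega)).symm
    have d1 : Nat.Coprime u 500 := by
      rw [show 500 = 2 ^ 2 * 5 ^ 3 by norm_num]
      exact (c2.pow_right 2).mul_right (c5.pow_right 3)
    apply Nat.Coprime.mul_right
    · exact Nat.Coprime.mul_left (by norm_num) (d1.pow_left 2)
    · exact Nat.Coprime.mul_left (c3.pow_right 4) (c1.pow 2 4)
  obtain ⟨k₁, k₂, r, s, hk, hkc, hr, hs, -, -⟩ := aux_fac _ _ 500 x (by norm_num) hcop hprod
  have hsum : k₁ * r ^ 4 + k₂ * s ^ 4 = 3 * u ^ 2 := by rw [← hr, ← hs]; omega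
  have : (k₁, k₂) ∈ (Nat.divisorsAntidiagonal 500).filter (fun p => Nat.Coprime p.1 p.2) := by
    exact Finset.mem_filter.2 ⟨Nat.mem_divisorsAntidiagonal.2 ⟨hk, by norm_num⟩, hkc⟩
  rw [show (Nat.divisorsAntidiagonal 500).filter (fun p => Nat.Coprime p.1 p.2) =
    {(1, 500), (4, 125), (125, 4), (500, 1)} by decide +kernel] at this
  have hr5 := aux_m5 r
  have hs5 := aux_m5 s
  have hu5' := aux_m5 u
  clear * - this hsum hr5 hs5 hu5 hu5'
  simp only [Finset.mem_insert, Finset.mem_singleton, Prod.mk.injEq] at this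
  rcases this with ⟨rfl, rfl⟩ | ⟨rfl, rfl⟩ | ⟨rfl, rfl⟩ | ⟨rfl, rfl⟩ <;> omega

set_option maxHeartbeats 1000000 in
theorem aux_S1 (r s u : ℕ) (hs0 : 0 < s) (hc : Nat.Coprime r s) (h2 : u % 2 = 1) (h3 : u % 3 ≠ 0)
    (h5 : u % 5 ≠ 0) (h : 4 * r ^ 4 + 1125 * s ^ 4 = u ^ 2) : False := by
  have r16 := aux_m16 r
  have s16 := aux_m16 s
  have u16 := aux_m16 u
  have r3 := aux_m3 r
  have u3 := aux_m3 u
  have r5 := aux_m5 r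
  have u5 := aux_m5 u
  have rr3 : r % 3 ≠ 0 := by clear * - h r3 u3 h3; omega
  have rr5 : r % 5 ≠ 0 := by clear * - h r5 u5 h5; omega
  have ss2 : s % 2 = 1 := by clear * - h s16 u16 h2; omega
  have rr2 : r % 2 = 1 := by
    have r16' : r ^ 4 % 4 = 0 ∨ r % 2 = 1 := by clear * - r16; omega
    clear * - h s16 u16 h2 r16' ss2; omega
  obtain ⟨A, rfl⟩ : ∃ A, u = 2 * r ^ 2 + A :=
    Nat.exists_eq_add_of_le (by
      by_contra hlt
      push Not at hlt
      linarith [Nat.zero_le (s ^ 4), Nat.pow_lt_pow_left hlt two_ne_zero])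
  have hprod : A * (A + 4 * r ^ 2) = 1125 * s ^ 4 := by linarith
  have hcop : Nat.Coprime A (A + 4 * r ^ 2) := by
    apply aux_cop2
    rw [hprod]
    have c3 := (aux_c3 r).2 rr3
    have c5 := (aux_c5 r).2 rr5
    have s2 := ((aux_c2 s).2 (by rw [ss2]; norm_num)).symm
    have d1 : Nat.Coprime r 1125 := by
      rw [show 1125 = 3 ^ 2 * 5 ^ 3 by norm_num]
      exact (c3.pow_right 2).mul_right (c5.pow_right 3)
    apply Nat.Coprime.mul_right
    · exact Nat.Coprime.mul_left (by norm_num) (d1.pow_left 2)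
    · exact Nat.Coprime.mul_left (s2.pow 2 4) (hc.pow 2 4)
  obtain ⟨k₁, k₂, α, β, hk, hkc, hr, hs, hαβ, -⟩ := aux_fac _ _ 1125 s (by norm_num) hcop hprod
  have hsum : k₁ * α ^ 4 + 4 * r ^ 2 = k₂ * β ^ 4 := by rw [← hr, ← hs]
  have : (k₁, k₂) ∈ (Nat.divisorsAntidiagonal 1125).filter (fun p => Nat.Coprime p.1 p.2) := by
    exact Finset.mem_filter.2 ⟨Nat.mem_divisorsAntidiagonal.2 ⟨hk, by norm_num⟩, hkc⟩
  rw [show (Nat.divisorsAntidiagonal 1125).filter (fun p => Nat.Coprime p.1 p.2) =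
    {(1, 1125), (9, 125), (125, 9), (1125, 1)} by decide +kernel] at this
  have hso := ss2
  rw [← hαβ, Nat.mul_mod] at hso
  have a16 := aux_m16 α
  have b16 := aux_m16 β
  have a2 : α % 2 = 1 := by
    rcases Nat.mod_two_eq_zero_or_one α with h | h
    · simp [h] at hso
    · exact h
  have b2 : β % 2 = 1 := by
    rcases Nat.mod_two_eq_zero_or_one β with h | h
    · simp [h] at hso
    · exact h
  have a3 := aux_m3 α
  have b3 := aux_m3 β
  have a16' : α ^ 4 % 16 = 1 := by clear * - a16 a2; omega
  have b16' : β ^ 4 % 16 = 1 := by clear * - b16 b2; omega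
  have r16' : r ^ 2 % 4 = 1 := by clear * - r16 rr2; omega
  have r3' : r ^ 2 % 3 = 1 := by clear * - r3 rr3; omega
  clear * - this hsum a16' b16' r16' r3' a3 b3
  simp only [Finset.mem_insert, Finset.mem_singleton, Prod.mk.injEq] at this
  rcases this with ⟨rfl, rfl⟩ | ⟨rfl, rfl⟩ | ⟨rfl, rfl⟩ | ⟨rfl, rfl⟩
  · clear a16' b16' r16'; omega
  · clear a16' b16' r16'; omega
  · clear a3 b3; omega
  · clear a3 b3; omega

set_option maxHeartbeats 1000000 in
theorem aux_S2 (r s u : ℕ) (hs0 : 0 < s) (hc : Nat.Coprime r s) (h2 : u % 2 = 1) (h3 : u % 3 ≠ 0)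
    (h5 : u % 5 ≠ 0) (h : 9 * r ^ 4 + 500 * s ^ 4 = u ^ 2) : False := by
  have r16 := aux_m16 r
  have s16 := aux_m16 s
  have u16 := aux_m16 u
  have s3 := aux_m3 s
  have u3 := aux_m3 u
  have r5 := aux_m5 r
  have u5 := aux_m5 u
  have ss3 : s % 3 ≠ 0 := by clear * - h s3 u3 h3; omega
  have rr5 : r % 5 ≠ 0 := by clear * - h r5 u5 h5; omega
  have rr2 : r % 2 = 1 := by clear * - h r16 u16 h2; omega
  have ss2 : s % 2 = 0 := by
    have r4 : r ^ 4 % 16 = 1 := by clear * - rr2 r16; omega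
    clear * - h u16 s16 h2 r4; omega
  clear r16 s16 s3 u3 u5
  obtain ⟨t, rfl⟩ : 2 ∣ s := Nat.dvd_of_mod_eq_zero ss2
  obtain ⟨A, rfl⟩ : ∃ A, u = 3 * r ^ 2 + 2 * A := by
    have : 3 * r ^ 2 ≤ u := by
      by_contra hlt
      push Not at hlt
      linarith [Nat.zero_le (t ^ 4), Nat.pow_lt_pow_left hlt two_ne_zero]
    have r16 := aux_m16 r
    exact ⟨(u - 3 * r ^ 2) / 2, by clear * - this r16 h2 rr2; omega⟩
  have hprod : A * (A + 3 * r ^ 2) = 2000 * t ^ 4 := by linarith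
  have hcop : Nat.Coprime A (A + 3 * r ^ 2) := by
    apply aux_cop2
    rw [hprod]
    have c2 := (aux_c2 r).2 (by rw [rr2]; norm_num)
    have c5 := (aux_c5 r).2 rr5
    have t3 := ((aux_c3 t).2 (by clear * - ss3; omega)).symm
    have d1 : Nat.Coprime r 2000 := by
      rw [show 2000 = 2 ^ 4 * 5 ^ 3 by norm_num]
      exact (c2.pow_right 4).mul_right (c5.pow_right 3)
    apply Nat.Coprime.mul_right
    · exact Nat.Coprime.mul_left (by norm_num) (d1.pow_left 2)
    · exact Nat.Coprime.mul_left (t3.pow_right 4) (hc.coprime_mul_left_right.pow 2 4)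
  obtain ⟨k₁, k₂, α, β, hk, hkc, hr, hs, hαβ, -⟩ :=
    aux_fac _ _ 2000 t (by norm_num) hcop hprod
  have hsum : k₁ * α ^ 4 + 3 * r ^ 2 = k₂ * β ^ 4 := by rw [← hr, ← hs]
  have : (k₁, k₂) ∈ (Nat.divisorsAntidiagonal 2000).filter (fun p => Nat.Coprime p.1 p.2) := by
    exact Finset.mem_filter.2 ⟨Nat.mem_divisorsAntidiagonal.2 ⟨hk, by norm_num⟩, hkc⟩
  rw [show (Nat.divisorsAntidiagonal 2000).filter (fun p => Nat.Coprime p.1 p.2) =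
    {(1, 2000), (16, 125), (125, 16), (2000, 1)} by decide +kernel] at this
  have rr := rr5
  have a5 := aux_m5 α
  have b5 := aux_m5 β
  clear * - this hsum a5 b5 rr r5
  simp only [Finset.mem_insert, Finset.mem_singleton, Prod.mk.injEq] at this
  rcases this with ⟨rfl, rfl⟩ | ⟨rfl, rfl⟩ | ⟨rfl, rfl⟩ | ⟨rfl, rfl⟩ <;> omega

set_option maxHeartbeats 1000000 in
theorem aux_S3 (r s u : ℕ) (hs0 : 0 < s) (hc : Nat.Coprime r s) (h2 : u % 2 = 1) (h3 : u % 3 ≠ 0)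
    (h5 : u % 5 ≠ 0) (h : 36 * r ^ 4 + 125 * s ^ 4 = u ^ 2) : False := by
  have r16 := aux_m16 r
  have s16 := aux_m16 s
  have u16 := aux_m16 u
  have s3 := aux_m3 s
  have u3 := aux_m3 u
  have r5 := aux_m5 r
  have u5 := aux_m5 u
  have ss3 : s % 3 ≠ 0 := by clear * - h s3 u3 h3; omega
  have rr5 : r % 5 ≠ 0 := by clear * - h r5 u5 h5; omega
  have ss2 : s % 2 = 1 := by clear * - h s16 u16 h2; omega
  clear r16 s16 u16 s3 u3 u5
  obtain ⟨A, rfl⟩ : ∃ A, u = 6 * r ^ 2 + A :=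
    Nat.exists_eq_add_of_le (by
      by_contra hlt
      push Not at hlt
      linarith [Nat.zero_le (s ^ 4), Nat.pow_lt_pow_left hlt two_ne_zero])
  have hprod : A * (A + 12 * r ^ 2) = 125 * s ^ 4 := by linarith
  have hcop : Nat.Coprime A (A + 12 * r ^ 2) := by
    apply aux_cop2
    rw [hprod]
    have c5 := (aux_c5 r).2 rr5
    have t3 := ((aux_c3 s).2 ss3).symm
    have t2 := ((aux_c2 s).2 (by rw [ss2]; norm_num)).symm
    have d1 : Nat.Coprime r 125 := by
      rw [show 125 = 5 ^ 3 by norm_num]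
      exact c5.pow_right 3
    have d2 : Nat.Coprime 12 s := by
      rw [show 12 = 2 ^ 2 * 3 by norm_num]
      exact (t2.pow_left 2).mul_left t3
    apply Nat.Coprime.mul_right
    · exact Nat.Coprime.mul_left (by norm_num) (d1.pow_left 2)
    · exact Nat.Coprime.mul_left (d2.pow_right 4) (hc.pow 2 4)
  obtain ⟨k₁, k₂, α, β, hk, hkc, hr, hs, hαβ, -⟩ :=
    aux_fac _ _ 125 s (by norm_num) hcop hprod
  have hsum : k₁ * α ^ 4 + 12 * r ^ 2 = k₂ * β ^ 4 := by rw [← hr, ← hs]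
  have : (k₁, k₂) ∈ (Nat.divisorsAntidiagonal 125).filter (fun p => Nat.Coprime p.1 p.2) := by
    exact Finset.mem_filter.2 ⟨Nat.mem_divisorsAntidiagonal.2 ⟨hk, by norm_num⟩, hkc⟩
  rw [show (Nat.divisorsAntidiagonal 125).filter (fun p => Nat.Coprime p.1 p.2) =
    {(1, 125), (125, 1)} by decide +kernel] at this
  have rr := rr5
  have a5 := aux_m5 α
  have b5 := aux_m5 β
  clear * - this hsum a5 b5 rr r5
  simp only [Finset.mem_insert, Finset.mem_singleton, Prod.mk.injEq] at this
  rcases this with ⟨rfl, rfl⟩ | ⟨rfl, rfl⟩ <;> omega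

set_option maxHeartbeats 1000000 in
theorem aux_S4 (r s u : ℕ) (hs0 : 0 < s) (hc : Nat.Coprime r s) (h2 : u % 2 = 1) (h3 : u % 3 ≠ 0)
    (h5 : u % 5 ≠ 0) (h : r ^ 4 + 4500 * s ^ 4 = u ^ 2) :
    ∃ α β, 0 < α ∧ 2 * α ≤ s ∧ Nat.Coprime β (6 * α) ∧ r ^ 2 + 18000 * α ^ 4 = β ^ 4 := by
  have r16 := aux_m16 r
  have s16 := aux_m16 s
  have u16 := aux_m16 u
  have r3 := aux_m3 r
  have u3 := aux_m3 u
  have r5 := aux_m5 r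
  have u5 := aux_m5 u
  have rr3 : r % 3 ≠ 0 := by clear * - h r3 u3 h3; omega
  have rr5 : r % 5 ≠ 0 := by clear * - h r5 u5 h5; omega
  have rr2 : r % 2 = 1 := by clear * - h r16 u16 h2; omega
  have ss2 : s % 2 = 0 := by
    have r4 : r ^ 4 % 16 = 1 := by clear * - rr2 r16; omega
    clear * - h u16 s16 h2 r4; omega
  have r8 : r ^ 2 % 8 = 1 := by clear * - rr2 r16; omega
  have r3' : r ^ 2 % 3 = 1 := by clear * - rr3 r3; omega
  clear r16 s16 r3 u3 r5 u5 u16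
  obtain ⟨t, rfl⟩ : 2 ∣ s := Nat.dvd_of_mod_eq_zero ss2
  obtain ⟨A, rfl⟩ : ∃ A, u = r ^ 2 + 2 * A := by
    have : r ^ 2 ≤ u := by
      by_contra hlt
      push Not at hlt
      linarith [Nat.zero_le (t ^ 4), Nat.pow_lt_pow_left hlt two_ne_zero]
    exact ⟨(u - r ^ 2) / 2, by clear * - this r8 h2; omega⟩
  have hprod : A * (A + r ^ 2) = 18000 * t ^ 4 := by linarith
  have hcop : Nat.Coprime A (A + r ^ 2) := by
    apply aux_cop2
    rw [hprod]
    have c2 := (aux_c2 r).2 (by rw [rr2]; norm_num)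
    have c3 := (aux_c3 r).2 rr3
    have c5 := (aux_c5 r).2 rr5
    have d1 : Nat.Coprime r 18000 := by
      rw [show 18000 = 2 ^ 4 * 3 ^ 2 * 5 ^ 3 by norm_num]
      exact ((c2.pow_right 4).mul_right (c3.pow_right 2)).mul_right (c5.pow_right 3)
    apply Nat.Coprime.mul_right
    · exact d1.pow_left 2
    · exact hc.coprime_mul_left_right.pow 2 4
  obtain ⟨k₁, k₂, α, β, hk, hkc, hr, hs, hαβ, hcαβ⟩ :=
    aux_fac _ _ 18000 t (by norm_num) hcop hprod
  have hsum : k₁ * α ^ 4 + r ^ 2 = k₂ * β ^ 4 := by rw [← hr, ← hs]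
  have : (k₁, k₂) ∈ (Nat.divisorsAntidiagonal 18000).filter (fun p => Nat.Coprime p.1 p.2) := by
    exact Finset.mem_filter.2 ⟨Nat.mem_divisorsAntidiagonal.2 ⟨hk, by norm_num⟩, hkc⟩
  rw [show (Nat.divisorsAntidiagonal 18000).filter (fun p => Nat.Coprime p.1 p.2) =
    {(1, 18000), (18000, 1), (16, 1125), (1125, 16), (9, 2000), (2000, 9), (125, 144), (144, 125)}
    by decide +kernel] at this
  have a3 := aux_m3 α
  have b3 := aux_m3 β
  have a16 := aux_m16 α
  have b16 := aux_m16 β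
  have ht : 0 < t := by omega
  have hα : 0 < α := Nat.pos_of_ne_zero (by rintro rfl; simp at hαβ; omega)
  have hβ : 0 < β := Nat.pos_of_ne_zero (by rintro rfl; simp at hαβ; omega)
  have hle : α ≤ t := by rw [← hαβ]; exact Nat.le_mul_of_pos_right _ hβ
  clear hr hs hprod hcop h h2 h3 h5
  simp only [Finset.mem_insert, Finset.mem_singleton, Prod.mk.injEq] at this
  rcases this with ⟨rfl, rfl⟩ | ⟨rfl, rfl⟩ | ⟨rfl, rfl⟩ | ⟨rfl, rfl⟩ | ⟨rfl, rfl⟩ |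
    ⟨rfl, rfl⟩ | ⟨rfl, rfl⟩ | ⟨rfl, rfl⟩
  · clear * - hsum r3' a3; omega
  · refine ⟨α, β, hα, by clear * - hle; omega, ?_, by clear * - hsum; omega⟩
    apply Nat.Coprime.mul_right _ hcαβ.symm
    rw [show 6 = 2 * 3 by norm_num]
    exact ((aux_c2 β).2 (by clear * - hsum r8 b16; omega)).mul_right
      ((aux_c3 β).2 (by clear * - hsum r3' b3; omega))
  · clear * - hsum r3' a3; omega
  · clear * - hsum r8 a16; omega
  · clear * - hsum r8 a16; omega
  · have := aux_caseA β (2 * α) r (by clear * - hα; omega)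
      (Nat.Coprime.mul_right ((aux_c2 β).2 (by clear * - hsum r8 b16; omega)) hcαβ.symm)
      (by rw [mul_pow]; clear * - hsum; omega)
    clear * - this hsum a3 r3'; omega
  · clear * - hsum r8 a16; omega
  · clear * - hsum r8 b16; omega

set_option maxHeartbeats 1000000 in
theorem aux_step (u w y : ℕ) (hw0 : 0 < w) (hc : Nat.Coprime u w)
    (h : y ^ 2 + 125 * w ^ 4 = 9 * u ^ 4) :
    ∃ u' w' y', 0 < w' ∧ w' < w ∧ Nat.Coprime u' w' ∧ y' ^ 2 + 125 * w' ^ 4 = 9 * u' ^ 4 := by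
  have hw3 := aux_caseA u w y hw0 hc h
  obtain ⟨hu, hw, hy, hu5⟩ := aux_basic u w y hc h
  obtain ⟨x, rfl⟩ : 6 ∣ w := by omega
  have hx : 0 < x := by omega
  have hu3 : u % 3 ≠ 0 := fun h0 => aux_not2 3 u _ (by norm_num) hc h0 hw3
  have y3 := aux_m3 y
  obtain ⟨z, rfl⟩ : 3 ∣ y := by
    have : y % 3 = 0 := by ring_nf at h y3; omega
    omega
  have h' : z ^ 2 + 18000 * x ^ 4 = u ^ 4 := by linarith
  have hlt : z ≤ u ^ 2 := by
    by_contra hlt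
    push Not at hlt
    linarith [Nat.zero_le (x ^ 4), Nat.pow_lt_pow_left hlt two_ne_zero]
  obtain ⟨A, hA⟩ : ∃ A, u ^ 2 = z + 2 * A := by
    refine ⟨(u ^ 2 - z) / 2, ?_⟩
    have := aux_m16 u
    omega
  have hprod : A * (A + z) = 4500 * x ^ 4 := by
    have : (u ^ 2) ^ 2 = (z + 2 * A) ^ 2 := by rw [hA]
    linarith
  have hcop : Nat.Coprime A (A + z) := by
    apply aux_cop
    rw [hprod, show A + (A + z) = u ^ 2 by omega]
    have c1 : Nat.Coprime u x := Nat.Coprime.coprime_mul_left_right hc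
    have c5 := (aux_c5 u).2 hu5
    have c2 := (aux_c2 u).2 (by omega)
    have c3 := (aux_c3 u).2 (by omega)
    have d1 : Nat.Coprime u 4500 := by
      rw [show 4500 = 2 ^ 2 * 3 ^ 2 * 5 ^ 3 by norm_num]
      exact ((c2.pow_right 2).mul_right (c3.pow_right 2)).mul_right (c5.pow_right 3)
    exact (d1.mul_right (c1.pow_right 4)).pow_left 2
  obtain ⟨k₁, k₂, r, s, hk, hkc, hr, hs, hrs, hcrs⟩ :=
    aux_fac _ _ 4500 x (by norm_num) hcop hprod
  have hsum : k₁ * r ^ 4 + k₂ * s ^ 4 = u ^ 2 := by rw [← hr, ← hs]; omega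
  have : (k₁, k₂) ∈ (Nat.divisorsAntidiagonal 4500).filter (fun p => Nat.Coprime p.1 p.2) := by
    exact Finset.mem_filter.2 ⟨Nat.mem_divisorsAntidiagonal.2 ⟨hk, by norm_num⟩, hkc⟩
  rw [show (Nat.divisorsAntidiagonal 4500).filter (fun p => Nat.Coprime p.1 p.2) =
    {(1, 4500), (4500, 1), (4, 1125), (1125, 4), (9, 500), (500, 9), (36, 125), (125, 36)}
    by decide +kernel] at this
  have hr0 : 0 < r := Nat.pos_of_ne_zero (by rintro rfl; simp at hrs; omega)
  have hs0 : 0 < s := Nat.pos_of_ne_zero (by rintro rfl; simp at hrs; omega)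
  have hle : r ≤ x := by rw [← hrs]; exact Nat.le_mul_of_pos_right _ hs0
  have hle2 : s ≤ x := by rw [← hrs]; exact Nat.le_mul_of_pos_left _ hr0
  clear hr hs hprod
  simp only [Finset.mem_insert, Finset.mem_singleton, Prod.mk.injEq] at this
  rcases this with ⟨rfl, rfl⟩ | ⟨rfl, rfl⟩ | ⟨rfl, rfl⟩ | ⟨rfl, rfl⟩ | ⟨rfl, rfl⟩ |
    ⟨rfl, rfl⟩ | ⟨rfl, rfl⟩ | ⟨rfl, rfl⟩
  · obtain ⟨α, β, h1, h2, h3, h4⟩ := aux_S4 r s u hs0 hcrs hu hu3 hu5 (by omega)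
    exact ⟨β, 6 * α, 3 * r, by omega, by omega, h3, by rw [← h4]; ring⟩
  · obtain ⟨α, β, h1, h2, h3, h4⟩ := aux_S4 s r u hr0 hcrs.symm hu hu3 hu5 (by omega)
    exact ⟨β, 6 * α, 3 * s, by omega, by omega, h3, by rw [← h4]; ring⟩
  · exact (aux_S1 r s u hs0 hcrs hu hu3 hu5 (by omega)).elim
  · exact (aux_S1 s r u hr0 hcrs.symm hu hu3 hu5 (by omega)).elim
  · exact (aux_S2 r s u hs0 hcrs hu hu3 hu5 (by omega)).elim
  · exact (aux_S2 s r u hr0 hcrs.symm hu hu3 hu5 (by omega)).elim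
  · exact (aux_S3 r s u hs0 hcrs hu hu3 hu5 (by omega)).elim
  · exact (aux_S3 s r u hr0 hcrs.symm hu hu3 hu5 (by omega)).elim

theorem aux_nat (w : ℕ) : ∀ u y : ℕ, 0 < w → Nat.Coprime u w →
    y ^ 2 + 125 * w ^ 4 = 9 * u ^ 4 → False := by
  induction w using Nat.strong_induction_on with
  | _ w ih =>
    intro u y hw hc h
    obtain ⟨u', w', y', h1, h2, h3, h4⟩ := aux_step u w y hw hc h
    exact ih w' h2 u' y' h1 h3 h4

/-- The affine form over the rationals: `q = u / w`. -/
theorem aux_rat (q t : ℚ) (h : t ^ 2 + 125 = 9 * q ^ 4) : False := by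
  have hd : (q.den : ℚ) ≠ 0 := by exact_mod_cast q.den_nz
  have hq : q * q.den = q.num := Rat.mul_den_eq_num q
  have hsq : (t * q.den ^ 2) ^ 2 = ((9 * q.num ^ 4 - 125 * q.den ^ 4 : ℤ) : ℚ) := by
    push_cast
    rw [← hq]
    linear_combination (q.den : ℚ) ^ 4 * h
  have hIs : IsSquare (((9 * q.num ^ 4 - 125 * q.den ^ 4 : ℤ)) : ℚ) :=
    ⟨t * q.den ^ 2, by rw [← hsq]; ring⟩
  rw [Rat.isSquare_intCast_iff] at hIs
  obtain ⟨m, hm⟩ := hIs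
  refine aux_nat q.den q.num.natAbs m.natAbs q.den_pos q.reduced ?_
  zify
  rw [sq_abs, Even.pow_abs (by decide)]
  linear_combination -hm

/-- If `u, v, y` are rational numbers, not both `u` and `v` zero, with
`5 y^2 = 45 u^4 - v^4`, then `v = 0`; in particular the only rational points
on the genus-1 curve `45 u^4 - v^4 = 5 y^2` are `(1 : 0 : ±3)`. -/
theorem rational_points_45u4_sub_v4_eq_5y2 (u v y : ℚ)
    (huv : (u, v) ≠ (0, 0))
    (h : 5 * y ^ 2 = 45 * u ^ 4 - v ^ 4) :
    v = 0 ∧ (y = 3 * u ^ 2 ∨ y = -(3 * u ^ 2)) := by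
  have hv : v = 0 := by
    by_contra hv
    apply aux_rat (5 * u / v) (25 * y / v ^ 2)
    field_simp
    linear_combination 125 * h
  subst hv
  refine ⟨rfl, ?_⟩
  apply sq_eq_sq_iff_eq_or_eq_neg.1
  linear_combination h / 5
end
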